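/- Let ξ ∈ F_q((T^{-1})) and n a positive integer. Then w_n(ξ) − n + 1 ≤ w_n^*(ξ) ≤ w_n(ξ). -/

import Mathlib

open Polynomial
open scoped Classical

namespace MahlerKoksmaFq

noncomputable section

variable (Fq : Type) [Field Fq] [Fintype Fq]

/-- `K Fq` models `F_q((T⁻¹))`: Laurent series in the variable `t = T⁻¹`. -/
abbrev K := LaurentSeries Fq

/-- The element `T` (the inverse of the Laurent-series variable `t = T⁻¹`). -/
def Tvar : K Fq := HahnSeries.single (-1 : ℤ) 1

/-- The absolute value `|ξ| = q^{-ν(ξ)}` on `F_q((T⁻¹))`. -/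
def absK (ξ : K Fq) : ℝ :=
  if ξ = 0 then 0 else (Fintype.card Fq : ℝ) ^ (-(HahnSeries.order ξ))

/-- The embedding of `F_q[T]` into `F_q((T⁻¹))`, sending `T` to `Tvar`. -/
def emb : Polynomial Fq →+* K Fq :=
  Polynomial.eval₂RingHom (algebraMap Fq (K Fq)) (Tvar Fq)

/-- Evaluation of `P ∈ F_q[T][X]` at `ξ ∈ F_q((T⁻¹))`. -/
def evalK (P : Polynomial (Polynomial Fq)) (ξ : K Fq) : K Fq :=
  P.eval₂ (emb Fq) ξ

/-- Height of a polynomial over `F_q[T]`: the maximum of the absolute values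
`q^{deg c}` of its coefficients. -/
def HP (P : Polynomial (Polynomial Fq)) : ℝ :=
  (Fintype.card Fq : ℝ) ^ (P.support.sup fun i => (P.coeff i).natDegree)

/-- `ξ` is algebraic (over `F_q[T]`) of degree at most `n`. -/
def IsAlgDegLe (ξ : K Fq) (n : ℕ) : Prop :=
  ∃ P : Polynomial (Polynomial Fq), P ≠ 0 ∧ P.natDegree ≤ n ∧ evalK Fq P ξ = 0

/-- `ξ` is algebraic over `F_q[T]`. -/
def IsAlgK (ξ : K Fq) : Prop :=
  ∃ P : Polynomial (Polynomial Fq), P ≠ 0 ∧ evalK Fq P ξ = 0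

/-- The degree of an algebraic element of `F_q((T⁻¹))`. -/
def degA (α : K Fq) : ℕ :=
  sInf {d | ∃ P : Polynomial (Polynomial Fq), P ≠ 0 ∧ P.natDegree = d ∧ evalK Fq P α = 0}

/-- The height of an algebraic element `α` of `F_q((T⁻¹))`: the least height of a
 nonzero annihilating polynomial of minimal degree (= height of the minimal
 defining polynomial over `F_q[T]`). -/
def HA (α : K Fq) : ℝ :=
  sInf {h | ∃ P : Polynomial (Polynomial Fq),
    P ≠ 0 ∧ P.natDegree = degA Fq α ∧ evalK Fq P α = 0 ∧ h = HP Fq P}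

/-- The defining set for Mahler's exponent `w_n`. -/
def wnSet (ξ : K Fq) (n : ℕ) : Set ℝ :=
  {w | {P : Polynomial (Polynomial Fq) |
      P.natDegree ≤ n ∧ 0 < absK Fq (evalK Fq P ξ) ∧
      absK Fq (evalK Fq P ξ) < HP Fq P ^ (-w)}.Infinite}

/-- Mahler's exponent `w_n(ξ)`. -/
def wn (ξ : K Fq) (n : ℕ) : EReal :=
  sSup ((fun w : ℝ => (w : EReal)) '' wnSet Fq ξ n)

/-- The defining set for `w_n^{sep}` (separable polynomials only). -/
def wnsepSet (ξ : K Fq) (n : ℕ) : Set ℝ :=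
  {w | {P : Polynomial (Polynomial Fq) |
      P.Separable ∧ P.natDegree ≤ n ∧ 0 < absK Fq (evalK Fq P ξ) ∧
      absK Fq (evalK Fq P ξ) < HP Fq P ^ (-w)}.Infinite}

/-- The exponent `w_n^{sep}(ξ)`. -/
def wnsep (ξ : K Fq) (n : ℕ) : EReal :=
  sSup ((fun w : ℝ => (w : EReal)) '' wnsepSet Fq ξ n)

/-- The defining set for Koksma's exponent `w_n^*` (approximation by algebraic
elements lying in `F_q((T⁻¹))`). -/
def wnstarSet (ξ : K Fq) (n : ℕ) : Set ℝ :=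
  {w | {α : K Fq | IsAlgK Fq α ∧ degA Fq α ≤ n ∧ 0 < absK Fq (ξ - α) ∧
      absK Fq (ξ - α) < HA Fq α ^ (-w - 1)}.Infinite}

/-- Koksma's exponent `w_n^*(ξ)`. -/
def wnstar (ξ : K Fq) (n : ℕ) : EReal :=
  sSup ((fun w : ℝ => (w : EReal)) '' wnstarSet Fq ξ n)

/-- The defining set for the uniform exponent `ŵ_n`. -/
def hwnSet (ξ : K Fq) (n : ℕ) : Set ℝ :=
  {w | ∃ H0 : ℝ, ∀ H : ℝ, H0 < H → ∃ P : Polynomial (Polynomial Fq),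
      P.natDegree ≤ n ∧ HP Fq P ≤ H ∧ 0 < absK Fq (evalK Fq P ξ) ∧
      absK Fq (evalK Fq P ξ) < H ^ (-w)}

/-- The uniform exponent `ŵ_n(ξ)`. -/
def hwn (ξ : K Fq) (n : ℕ) : EReal :=
  sSup ((fun w : ℝ => (w : EReal)) '' hwnSet Fq ξ n)

/-- The defining set for the uniform exponent `ŵ_n^{sep}` (separable polynomials only). -/
def hwnsepSet (ξ : K Fq) (n : ℕ) : Set ℝ :=
  {w | ∃ H0 : ℝ, ∀ H : ℝ, H0 < H → ∃ P : Polynomial (Polynomial Fq),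
      P.Separable ∧ P.natDegree ≤ n ∧ HP Fq P ≤ H ∧ 0 < absK Fq (evalK Fq P ξ) ∧
      absK Fq (evalK Fq P ξ) < H ^ (-w)}

/-- The uniform exponent `ŵ_n^{sep}(ξ)`. -/
def hwnsep (ξ : K Fq) (n : ℕ) : EReal :=
  sSup ((fun w : ℝ => (w : EReal)) '' hwnsepSet Fq ξ n)

/-- The fractional part of a Laurent series in `T⁻¹`: the part with only
 negative powers of `T` (positive powers of the series variable `t = T⁻¹`). -/
def fracPart (η : K Fq) : K Fq :=
  { coeff := fun m => if 0 < m then η.coeff m else 0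
    isPWO_support' := η.isPWO_support'.mono (fun m hm => by
      by_cases h : 0 < m
      · simpa [Function.mem_support, h] using hm
      · simp [Function.mem_support, h] at hm) }

/-- The fractional-part norm `‖η‖ = |η - [η]|`. -/
def fracNorm (η : K Fq) : ℝ := absK Fq (fracPart Fq η)

/-- `max{‖R(T)ξ‖, …, ‖R(T)ξⁿ‖}`. -/
def maxFrac (ξ : K Fq) (n : ℕ) (R : Polynomial Fq) : ℝ :=
  sSup ((fun i => fracNorm Fq (emb Fq R * ξ ^ i)) '' Set.Icc 1 n)

/-- The defining set for the exponent of simultaneous approximation `λ_n`. -/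
def lamSet (ξ : K Fq) (n : ℕ) : Set ℝ :=
  {l | {R : Polynomial Fq | 0 < maxFrac Fq ξ n R ∧
      maxFrac Fq ξ n R < (Fintype.card Fq : ℝ) ^ (-(l * R.natDegree))}.Infinite}

/-- The exponent of simultaneous approximation `λ_n(ξ)`. -/
def lam (ξ : K Fq) (n : ℕ) : EReal :=
  sSup ((fun w : ℝ => (w : EReal)) '' lamSet Fq ξ n)

/-- The defining set for the uniform exponent `λ̂_n`. -/
def hlamSet (ξ : K Fq) (n : ℕ) : Set ℝ :=
  {l | ∃ d0 : ℕ, ∀ d : ℕ, d0 < d → ∃ R : Polynomial Fq, R.natDegree ≤ d ∧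
      0 < maxFrac Fq ξ n R ∧
      maxFrac Fq ξ n R < (Fintype.card Fq : ℝ) ^ (-(l * d))}

/-- The uniform exponent `λ̂_n(ξ)`. -/
def hlam (ξ : K Fq) (n : ℕ) : EReal :=
  sSup ((fun w : ℝ => (w : EReal)) '' hlamSet Fq ξ n)

/-- An algebraic closure of `F_q((T⁻¹))`; its algebraic elements are exactly the
algebraic elements of the completion `C_∞`. -/
abbrev Kbar := AlgebraicClosure (K Fq)

/-- The embedding of `F_q[T]` into the algebraic closure. -/
def embbar : Polynomial Fq →+* Kbar Fq :=
  (algebraMap (K Fq) (Kbar Fq)).comp (emb Fq)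

/-- Evaluation of `P ∈ F_q[T][X]` at a point of the algebraic closure. -/
def evalKbar (P : Polynomial (Polynomial Fq)) (x : Kbar Fq) : Kbar Fq :=
  P.eval₂ (embbar Fq) x

/-- The unique extension of the absolute value of `F_q((T⁻¹))` to its algebraic
closure: `|x| = |N(x)|^{1/d} = |a_0|^{1/d}` where `a_0` is the constant term and
`d` the degree of the minimal polynomial of `x` over `F_q((T⁻¹))`. -/
def absC (x : Kbar Fq) : ℝ :=
  absK Fq ((minpoly (K Fq) x).coeff 0) ^ ((1 : ℝ) / (minpoly (K Fq) x).natDegree)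

/-- `x ∈ C_∞` is algebraic over `F_q[T]`. -/
def IsAlgKbar (x : Kbar Fq) : Prop :=
  ∃ P : Polynomial (Polynomial Fq), P ≠ 0 ∧ evalKbar Fq P x = 0

/-- Degree over `F_q[T]` of an algebraic element of `C_∞`. -/
def degAbar (x : Kbar Fq) : ℕ :=
  sInf {d | ∃ P : Polynomial (Polynomial Fq), P ≠ 0 ∧ P.natDegree = d ∧ evalKbar Fq P x = 0}

/-- Height of an algebraic element of `C_∞`. -/
def HAbar (x : Kbar Fq) : ℝ :=
  sInf {h | ∃ P : Polynomial (Polynomial Fq),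
    P ≠ 0 ∧ P.natDegree = degAbar Fq x ∧ evalKbar Fq P x = 0 ∧ h = HP Fq P}

/-- The defining set for the exponent `w_n^@` (approximation by algebraic
elements of `C_∞`). -/
def wnAtSet (ξ : K Fq) (n : ℕ) : Set ℝ :=
  {w | {α : Kbar Fq | IsAlgKbar Fq α ∧ degAbar Fq α ≤ n ∧
      0 < absC Fq (algebraMap (K Fq) (Kbar Fq) ξ - α) ∧
      absC Fq (algebraMap (K Fq) (Kbar Fq) ξ - α) < HAbar Fq α ^ (-w - 1)}.Infinite}

/-- The exponent `w_n^@(ξ)`. -/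
def wnAt (ξ : K Fq) (n : ℕ) : EReal :=
  sSup ((fun w : ℝ => (w : EReal)) '' wnAtSet Fq ξ n)

/-- The defining set for the uniform exponent `ŵ_n^@`. -/
def hwnAtSet (ξ : K Fq) (n : ℕ) : Set ℝ :=
  {w | ∃ H0 : ℝ, ∀ H : ℝ, H0 < H → ∃ α : Kbar Fq, IsAlgKbar Fq α ∧ degAbar Fq α ≤ n ∧
      HAbar Fq α ≤ H ∧ 0 < absC Fq (algebraMap (K Fq) (Kbar Fq) ξ - α) ∧
      absC Fq (algebraMap (K Fq) (Kbar Fq) ξ - α) < (HAbar Fq α)⁻¹ * H ^ (-w)}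

/-- The uniform exponent `ŵ_n^@(ξ)`. -/
def hwnAt (ξ : K Fq) (n : ℕ) : EReal :=
  sSup ((fun w : ℝ => (w : EReal)) '' hwnAtSet Fq ξ n)

/-- `w(ξ) = limsup_n w_n(ξ)/n`. -/
def wlim (ξ : K Fq) : EReal :=
  Filter.atTop.limsup fun n : ℕ => wn Fq ξ n * (((n : ℝ)⁻¹ : ℝ) : EReal)

/-- `w^*(ξ) = limsup_n w_n^*(ξ)/n`. -/
def wlimstar (ξ : K Fq) : EReal :=
  Filter.atTop.limsup fun n : ℕ => wnstar Fq ξ n * (((n : ℝ)⁻¹ : ℝ) : EReal)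

/-- Height of a polynomial over `C_∞`: maximum of the absolute values of its
coefficients. -/
def HC (P : Polynomial (Kbar Fq)) : ℝ :=
  sSup ((fun i => absC Fq (P.coeff i)) '' Set.Iic P.natDegree)



theorem q_gt_one : (1 : ℝ) < (Fintype.card Fq : ℝ) := by
  exact_mod_cast Fintype.one_lt_card

theorem q_pos : (0 : ℝ) < (Fintype.card Fq : ℝ) := by
  linarith [q_gt_one Fq]

theorem absK_zero : absK Fq 0 = 0 := by simp [absK]

theorem absK_of_ne {x : K Fq} (hx : x ≠ 0) :
    absK Fq x = (Fintype.card Fq : ℝ) ^ (-(HahnSeries.order x)) := by simp [absK, hx]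

theorem absK_pos {x : K Fq} (hx : x ≠ 0) : 0 < absK Fq x := by
  rw [absK_of_ne Fq hx]; exact zpow_pos (q_pos Fq) _

theorem absK_nonneg (x : K Fq) : 0 ≤ absK Fq x := by
  by_cases hx : x = 0
  · rw [hx, absK_zero]
  · exact (absK_pos Fq hx).le

theorem absK_pos_iff {x : K Fq} : 0 < absK Fq x ↔ x ≠ 0 := by
  refine ⟨fun h h0 => ?_, absK_pos Fq⟩
  rw [h0, absK_zero] at h; exact lt_irrefl _ h

theorem absK_mul (x y : K Fq) : absK Fq (x * y) = absK Fq x * absK Fq y := by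
  by_cases hx : x = 0
  · simp [hx, absK_zero]
  by_cases hy : y = 0
  · simp [hy, absK_zero]
  rw [absK_of_ne Fq hx, absK_of_ne Fq hy, absK_of_ne Fq (mul_ne_zero hx hy),
    HahnSeries.order_mul hx hy, neg_add, zpow_add₀ (q_pos Fq).ne']

/-- `|x| ≤ q^{-N}` iff all coefficients below `N` vanish. -/
theorem absK_le_iff (x : K Fq) (N : ℤ) :
    absK Fq x ≤ (Fintype.card Fq : ℝ) ^ (-N) ↔ ∀ m < N, x.coeff m = 0 := by
  by_cases hx : x = 0
  · simp only [hx, absK_zero, HahnSeries.coeff_zero, implies_true, iff_true]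
    exact (zpow_pos (q_pos Fq) _).le
  rw [absK_of_ne Fq hx, zpow_le_zpow_iff_right₀ (q_gt_one Fq)]
  constructor
  · intro h m hm
    exact HahnSeries.coeff_eq_zero_of_lt_order (by omega)
  · intro h
    by_contra hlt
    exact HahnSeries.coeff_order_eq_zero.not.mpr hx (h _ (by omega))

theorem absK_add_le (x y : K Fq) : absK Fq (x + y) ≤ max (absK Fq x) (absK Fq y) := by
  by_cases hx : x = 0
  · simp [hx, absK_zero]
  by_cases hy : y = 0
  · simp [hy, absK_zero]
  wlog h : HahnSeries.order x ≤ HahnSeries.order y generalizing x y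
  · rw [add_comm, max_comm]; exact this y x hy hx (by omega)
  refine le_trans ?_ (le_max_left _ _)
  rw [absK_of_ne Fq hx, absK_le_iff]
  intro m hm
  rw [HahnSeries.coeff_add, HahnSeries.coeff_eq_zero_of_lt_order hm,
    HahnSeries.coeff_eq_zero_of_lt_order (by omega), add_zero]

/-- `absK` as an absolute value. -/
def absV : AbsoluteValue (K Fq) ℝ where
  toFun := absK Fq
  map_mul' := absK_mul Fq
  nonneg' := absK_nonneg Fq
  eq_zero' x := by
    constructor
    · intro h; by_contra hx; exact (absK_pos Fq hx).ne' h
    · rintro rfl; exact absK_zero Fq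
  add_le' x y := (absK_add_le Fq x y).trans
    (max_le_add_of_nonneg (absK_nonneg Fq x) (absK_nonneg Fq y))

theorem absV_apply (x : K Fq) : absV Fq x = absK Fq x := rfl

theorem absK_one : absK Fq 1 = 1 := (absV Fq).map_one
theorem absK_neg (x : K Fq) : absK Fq (-x) = absK Fq x := (absV Fq).map_neg x
theorem absK_pow (x : K Fq) (n : ℕ) : absK Fq (x ^ n) = absK Fq x ^ n := (absV Fq).map_pow x n
theorem absK_sub_comm (x y : K Fq) : absK Fq (x - y) = absK Fq (y - x) := (absV Fq).map_sub x y

theorem coeff_emb (P : Polynomial Fq) (m : ℤ) :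
    (emb Fq P).coeff m = if m ≤ 0 then P.coeff (-m).toNat else 0 := by
  induction P using Polynomial.induction_on' with
  | add p q hp hq =>
    rw [map_add, HahnSeries.coeff_add, hp, hq]; split_ifs <;> simp
  | monomial k a =>
    have : emb Fq (Polynomial.monomial k a) = HahnSeries.single (-(k:ℤ)) a := by
      simp [emb, Tvar, HahnSeries.single_pow, Polynomial.eval₂_monomial, LaurentSeries.algebraMap_apply,
        HahnSeries.C_apply, HahnSeries.single_mul_single]
    rw [this, HahnSeries.coeff_single, Polynomial.coeff_monomial]
    split_ifs <;> first | rfl | omega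

theorem absK_emb {P : Polynomial Fq} (hP : P ≠ 0) :
    absK Fq (emb Fq P) = (Fintype.card Fq : ℝ) ^ P.natDegree := by
  apply le_antisymm
  · have := (absK_le_iff Fq (emb Fq P) (-(P.natDegree : ℤ))).2 ?_
    · simpa using this
    · intro m hm
      rw [coeff_emb]; split_ifs with h
      · exact Polynomial.coeff_eq_zero_of_natDegree_lt (by omega)
      · rfl
  · by_contra hlt
    have h0 : (emb Fq P).coeff (-(P.natDegree:ℤ)) ≠ 0 := by
      rw [coeff_emb]; simp [hP]
    have hne : emb Fq P ≠ 0 := by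
      intro h; rw [h] at h0; simp at h0
    have := HahnSeries.order_le_of_coeff_ne_zero h0
    apply hlt
    rw [absK_of_ne Fq hne, ← zpow_natCast]
    exact zpow_le_zpow_right₀ (q_gt_one Fq).le (by omega)

theorem emb_injective : Function.Injective (emb Fq) := by
  rw [injective_iff_map_eq_zero]
  intro P h
  by_contra hP
  have := absK_emb Fq hP
  rw [h, absK_zero] at this
  exact (pow_pos (q_pos Fq) _).ne this

theorem one_le_absK_emb {P : Polynomial Fq} (hP : P ≠ 0) : 1 ≤ absK Fq (emb Fq P) := by
  rw [absK_emb Fq hP]; exact one_le_pow₀ (q_gt_one Fq).le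

theorem absK_emb_le (P : Polynomial Fq) :
    absK Fq (emb Fq P) ≤ (Fintype.card Fq : ℝ) ^ P.natDegree := by
  by_cases hP : P = 0
  · simp [hP, absK_zero]
  · exact (absK_emb Fq hP).le

theorem isNonarch_absV : IsNonarchimedean (absV Fq) := fun x y => absK_add_le Fq x y

/-- The normed field structure on `K` given by `absK`. -/
@[reducible] def normK : NormedField (K Fq) := (absV Fq).toNormedField

theorem complete_normK : @CompleteSpace (K Fq) (normK Fq).toMetricSpace.toUniformSpace := by
  let _ := normK Fq
  refine Metric.complete_of_cauchySeq_tendsto (α := K Fq) ?_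
  intro u hu
  rw [Metric.cauchySeq_iff] at hu
  have hd : ∀ x y : K Fq, dist x y = absK Fq (x - y) := by
    intro x y
    rw [dist_eq_norm (E := K Fq)]; rfl
  have h1 : ∀ N : ℤ, ∃ M : ℕ, ∀ m ≥ M, ∀ m' ≥ M, ∀ k ≤ N, (u m).coeff k = (u m').coeff k := by
    intro N
    obtain ⟨M, hM⟩ := hu ((Fintype.card Fq : ℝ) ^ (-(N+1))) (zpow_pos (q_pos Fq) _)
    refine ⟨M, fun m hm m' hm' k hk => ?_⟩
    have := (hM m hm m' hm').le
    rw [hd, absK_le_iff] at this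
    have := this k (by omega)
    rwa [HahnSeries.coeff_sub, sub_eq_zero] at this
  choose M hM using h1
  have hkey : ∀ N : ℤ, ∀ m ≥ M N, ∀ k ≤ N, (u (M k)).coeff k = (u m).coeff k := by
    intro N m hm k hk
    rw [hM k (M k) le_rfl (max (M k) m) (le_max_left _ _) k le_rfl,
      hM N m hm (max (M k) m) (hm.trans (le_max_right _ _)) k hk]
  let f : ℤ → Fq := fun k => (u (M k)).coeff k
  have hb : BddBelow (Function.support f) := by
    refine ⟨min 0 (u (M 0)).order, ?_⟩
    intro k hk
    by_contra hlt
    rw [not_le, lt_min_iff] at hlt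
    apply hk
    change (u (M k)).coeff k = 0
    rw [hkey 0 (M 0) le_rfl k hlt.1.le]
    exact HahnSeries.coeff_eq_zero_of_lt_order hlt.2
  refine ⟨HahnSeries.ofSuppBddBelow f hb, ?_⟩
  rw [Metric.tendsto_atTop]
  intro ε hε
  obtain ⟨N, hN⟩ := exists_pow_lt_of_lt_one hε (inv_lt_one_of_one_lt₀ (q_gt_one Fq))
  refine ⟨M N, fun m hm => ?_⟩
  rw [hd]
  refine lt_of_le_of_lt ?_ hN
  have := (absK_le_iff Fq (u m - HahnSeries.ofSuppBddBelow f hb) N).2 ?_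
  · simpa using this
  · intro k hk
    rw [HahnSeries.coeff_sub, sub_eq_zero]
    exact (hkey N m hm k hk.le).symm

theorem exists_ext_general {k L : Type} [Field k] [Field L] [Algebra k L]
    [Algebra.IsAlgebraic k L] (w : AbsoluteValue k ℝ) (hna : IsNonarchimedean w)
    (hnt : ∃ x, 1 < w x)
    (hc : @CompleteSpace k w.toNormedField.toMetricSpace.toUniformSpace) :
    ∃ v : AbsoluteValue L ℝ, IsNonarchimedean v ∧
    (∀ x : k, v (algebraMap k L x) = w x) ∧
    (∀ x y : L, minpoly k x = minpoly k y → v x = v y) := by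
  let i1 : NontriviallyNormedField k :=
    { w.toNormedField with
      non_trivial := hnt }
  have i2 : CompleteSpace k := hc
  have i3 : IsUltrametricDist k :=
    IsUltrametricDist.isUltrametricDist_of_forall_norm_add_le_max_norm hna
  let f := spectralMulAlgNorm k L
  refine ⟨{ toFun := fun x => spectralNorm k L x
            map_mul' := fun x y => map_mul f x y
            nonneg' := fun x => spectralNorm_nonneg x
            eq_zero' := fun x => map_eq_zero_iff_eq_zero f
            add_le' := fun x y => map_add_le_add f x y }, ?_, ?_, ?_⟩
  · exact isNonarchimedean_spectralNorm
  · intro x; exact spectralNorm_extends x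
  · intro x y h
    change spectralNorm _ _ _ = spectralNorm _ _ _
    simp only [spectralNorm, h]

theorem exists_ext : ∃ v : AbsoluteValue (Kbar Fq) ℝ, IsNonarchimedean v ∧
    (∀ x : K Fq, v (algebraMap (K Fq) (Kbar Fq) x) = absK Fq x) ∧
    (∀ x y : Kbar Fq, minpoly (K Fq) x = minpoly (K Fq) y → v x = v y) :=
  exists_ext_general (absV Fq) (isNonarch_absV Fq)
    ⟨emb Fq X, by
        rw [absV_apply, absK_emb Fq X_ne_zero]; simpa using q_gt_one Fq⟩ (complete_normK Fq)

theorem abv_sum_le {R : Type} [Ring R] (v : AbsoluteValue R ℝ) (hna : IsNonarchimedean v)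
    {ι : Type} (s : Finset ι) (f : ι → R) (B : ℝ) (hB : 0 ≤ B) (h : ∀ i ∈ s, v (f i) ≤ B) :
    v (∑ i ∈ s, f i) ≤ B := by
  induction s using Finset.induction_on with
  | empty => simpa using hB
  | insert a s ha ih =>
    rw [Finset.sum_insert ha]
    exact (hna _ _).trans (max_le (h a (by simp)) (ih fun i hi => h i (by simp [hi])))

section gauss
variable {L : Type} [Field L] (v : AbsoluteValue L ℝ) (hna : IsNonarchimedean v)

/-- The Gauss norm as an absolute value. -/
def gn (hna : IsNonarchimedean v) : AbsoluteValue L[X] ℝ :=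
  @IsAbsoluteValue.toAbsoluteValue ℝ _ _ _ _ (gaussNorm v 1)
    (gaussNorm_isAbsoluteValue hna one_pos)

theorem gn_apply (p : L[X]) : gn v hna p = gaussNorm v 1 p := rfl

theorem gn_nonarch : IsNonarchimedean (gn v hna) :=
  isNonarchimedean_gaussNorm v hna zero_le_one

theorem coeff_le_gn (p : L[X]) (i : ℕ) : v (p.coeff i) ≤ gn v hna p := by
  simpa [gn_apply] using le_gaussNorm (v := v) (c := 1) (p := p) zero_le_one i

theorem gn_le {p : L[X]} {B : ℝ} (h : ∀ i, v (p.coeff i) ≤ B) : gn v hna p ≤ B := by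
  obtain ⟨i, hi⟩ := exists_eq_gaussNorm v 1 p
  rw [gn_apply, hi]; simpa using h i

theorem gn_X_add_C_le {x : L} {c : ℝ} (hc : 1 ≤ c) (hx : v x ≤ c) :
    gn v hna (X + C x) ≤ c := by
  refine (gn_nonarch v hna _ _).trans (max_le ?_ ?_)
  · apply gn_le; intro i; rw [coeff_X]; split_ifs
    · simpa using hc
    · simpa using zero_le_one.trans hc
  · apply gn_le; intro i; rw [coeff_C]; split_ifs
    · exact hx
    · simpa using zero_le_one.trans hc

theorem gn_C (x : L) : gn v hna (C x) = v x := by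
  rw [gn_apply, gaussNorm_C]

theorem max_le_gn_X_add_C (x : L) : max 1 (v x) ≤ gn v hna (X + C x) := by
  apply max_le
  · have := coeff_le_gn v hna (X + C x) 1
    rw [coeff_add, coeff_X_one, coeff_C_succ, add_zero, v.map_one] at this
    exact this
  · have := coeff_le_gn v hna (X + C x) 0
    rw [coeff_add, coeff_X_zero, coeff_C_zero, zero_add] at this
    exact this

theorem gn_comp_le {p : L[X]} {n : ℕ} (hn : p.natDegree ≤ n) {B c : ℝ} (hB : 0 ≤ B)
    (hp : ∀ i, v (p.coeff i) ≤ B) (hc : 1 ≤ c) {x : L} (hx : v x ≤ c) :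
    gn v hna (p.comp (X + C x)) ≤ B * c ^ n := by
  rw [comp_eq_sum_left, sum_over_range' _ (by simp) (n + 1) (by omega)]
  apply abv_sum_le _ (gn_nonarch v hna)
  · positivity
  · intro i hi
    rw [map_mul, map_pow, gn_C]
    have h1 := gn_X_add_C_le v hna hc hx
    have h2 : (gn v hna (X + C x)) ^ i ≤ c ^ n :=
      (pow_le_pow_left₀ ((gn v hna).nonneg _) h1 i).trans
        (pow_le_pow_right₀ hc (by have := Finset.mem_range.1 hi; omega))
    exact mul_le_mul (hp i) h2 (pow_nonneg ((gn v hna).nonneg _) _) hB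

theorem eval_le {p : L[X]} {n : ℕ} (hn : p.natDegree ≤ n) {B c : ℝ} (hB : 0 ≤ B)
    (hp : ∀ i, v (p.coeff i) ≤ B) (hc : 1 ≤ c) {x : L} (hx : v x ≤ c) (hna : IsNonarchimedean v) :
    v (p.eval x) ≤ B * c ^ n := by
  have := coeff_le_gn v hna (p.comp (X + C x)) 0
  rw [coeff_zero_eq_eval_zero, eval_comp] at this
  simp only [eval_add, eval_X, eval_C, zero_add] at this
  exact this.trans (gn_comp_le v hna hn hB hp hc hx)

theorem eval_le_of_root {p : L[X]} {n : ℕ} (hn : p.natDegree ≤ n) {B c : ℝ} (hB : 0 ≤ B)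
    (hp : ∀ i, v (p.coeff i) ≤ B) (hc : 1 ≤ c) {x y : L} (hx : v x ≤ c)
    (hna : IsNonarchimedean v) (hy : p.eval y = 0) (hxy : v (x - y) ≤ 1) :
    v (p.eval x) ≤ v (x - y) * (B * c ^ n) := by
  set t := p.comp (X + C x) with ht
  have h0 : t.eval (y - x) = 0 := by simp [ht, eval_comp, hy]
  have h1 : t.eval 0 = p.eval x := by simp [ht, eval_comp]
  have hg := gn_comp_le v hna hn hB hp hc hx
  have h2 : p.eval x = - ((y - x) * (t.divX).eval (y - x)) := by
    have := divX_mul_X_add t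
    have h3 := congrArg (eval (y - x)) this
    rw [h0, coeff_zero_eq_eval_zero, h1] at h3
    simp only [eval_add, eval_mul, eval_X, eval_C] at h3
    linear_combination h3
  rw [h2, v.map_neg, map_mul, v.map_sub]
  apply mul_le_mul_of_nonneg_left _ (v.nonneg _)
  have := eval_le v (p := t.divX) (n := t.divX.natDegree) le_rfl (B := B * c ^ n) (c := 1)
    (by positivity) (fun i => by
      rw [coeff_divX]; exact (coeff_le_gn v hna t _).trans hg) le_rfl (x := y - x)
      (by rw [v.map_sub]; exact hxy) hna
  simpa using this

/-- Mahler-measure bound from the Gauss norm, centred at `x`. -/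
theorem mahler_le {p : L[X]} (hs : p.Splits) {n : ℕ} (hn : p.natDegree ≤ n) {B c : ℝ}
    (hB : 0 ≤ B) (hp : ∀ i, v (p.coeff i) ≤ B) (hc : 1 ≤ c) {x : L} (hx : v x ≤ c)
    (hna : IsNonarchimedean v) :
    v p.leadingCoeff * (p.roots.map fun a => max 1 (v (x - a))).prod ≤ B * c ^ n := by
  refine le_trans ?_ (gn_comp_le v hna hn hB hp hc hx)
  conv_rhs => rw [hs.eq_prod_roots]
  rw [mul_comp, C_comp, multiset_prod_comp, map_mul, gn_C, map_multiset_prod, Multiset.map_map,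
    Multiset.map_map]
  apply mul_le_mul_of_nonneg_left _ (v.nonneg _)
  apply Multiset.prod_map_le_prod_map₀
  · intro a _; positivity
  · intro a _
    have := max_le_gn_X_add_C v hna (x - a)
    simp only [Function.comp, sub_comp, X_comp, C_comp]
    have e : (X + C x - C a : L[X]) = X + C (x - a) := by rw [C_sub]; ring
    rw [e]; exact this

end gauss

theorem one_le_HP (P : Polynomial (Polynomial Fq)) : 1 ≤ HP Fq P :=
  one_le_pow₀ (q_gt_one Fq).le

theorem HP_pos (P : Polynomial (Polynomial Fq)) : 0 < HP Fq P :=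
  zero_lt_one.trans_le (one_le_HP Fq P)

theorem natDegree_coeff_le (P : Polynomial (Polynomial Fq)) (i : ℕ) :
    (P.coeff i).natDegree ≤ P.support.sup fun i => (P.coeff i).natDegree := by
  by_cases h : i ∈ P.support
  · exact Finset.le_sup (f := fun i => (P.coeff i).natDegree) h
  · rw [notMem_support_iff] at h; simp [h]

theorem absK_coeff_le (P : Polynomial (Polynomial Fq)) (i : ℕ) :
    absK Fq (emb Fq (P.coeff i)) ≤ HP Fq P :=
  (absK_emb_le Fq _).trans
    (pow_le_pow_right₀ (q_gt_one Fq).le (natDegree_coeff_le Fq P i))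

theorem HP_eq_gn {P : Polynomial (Polynomial Fq)} (hP : P ≠ 0) :
    HP Fq P = gn (absV Fq) (isNonarch_absV Fq) (P.map (emb Fq)) := by
  apply le_antisymm
  · obtain ⟨i, hi, h⟩ := Finset.exists_mem_eq_sup P.support (support_nonempty.2 hP)
      (fun i => (P.coeff i).natDegree)
    have := coeff_le_gn (absV Fq) (isNonarch_absV Fq) (P.map (emb Fq)) i
    rw [coeff_map, absV_apply, absK_emb Fq (mem_support_iff.1 hi)] at this
    rw [HP, h]; exact this
  · apply gn_le
    intro i
    rw [coeff_map]; exact absK_coeff_le Fq P i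

theorem HP_mul {P Q : Polynomial (Polynomial Fq)} (hP : P ≠ 0) (hQ : Q ≠ 0) :
    HP Fq (P * Q) = HP Fq P * HP Fq Q := by
  rw [HP_eq_gn Fq hP, HP_eq_gn Fq hQ, HP_eq_gn Fq (mul_ne_zero hP hQ), Polynomial.map_mul,
    map_mul]

theorem HP_le_of_dvd {P Q : Polynomial (Polynomial Fq)} (h : P ∣ Q) (hQ : Q ≠ 0) :
    HP Fq P ≤ HP Fq Q := by
  obtain ⟨R, rfl⟩ := h
  rw [HP_mul Fq (left_ne_zero_of_mul hQ) (right_ne_zero_of_mul hQ)]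
  exact le_mul_of_one_le_right (HP_pos Fq P).le (one_le_HP Fq R)

theorem finite_natDegree_le {R : Type} [Semiring R] (n : ℕ) (S : Set R) (hS : S.Finite) :
    {P : Polynomial R | P.natDegree ≤ n ∧ ∀ i, P.coeff i ∈ S}.Finite := by
  have : Finite S := hS
  refine Set.Finite.of_injOn (f := fun P : Polynomial R => fun i : Fin (n+1) => P.coeff i)
    (t := Set.pi Set.univ fun _ => S) ?_ ?_ (Set.Finite.pi fun _ => hS)
  · intro P hP i _; exact hP.2 i
  · intro P hP Q hQ h
    ext i
    by_cases hi : i < n + 1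
    · exact congrFun h ⟨i, hi⟩
    · rw [coeff_eq_zero_of_natDegree_lt (by have := hP.1; omega),
        coeff_eq_zero_of_natDegree_lt (by have := hQ.1; omega)]

theorem finite_HP_le (n : ℕ) (B : ℝ) :
    {P : Polynomial (Polynomial Fq) | P.natDegree ≤ n ∧ HP Fq P ≤ B}.Finite := by
  obtain ⟨m, hm⟩ := pow_unbounded_of_one_lt B (q_gt_one Fq)
  refine (finite_natDegree_le n _ (finite_natDegree_le m (Set.univ : Set Fq) Set.finite_univ)).subset ?_
  rintro P ⟨h1, h2⟩
  refine ⟨h1, fun i => ⟨?_, fun _ => trivial⟩⟩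
  have h3 := h2.trans hm.le
  rw [HP, pow_le_pow_iff_right₀ (q_gt_one Fq)] at h3
  exact (natDegree_coeff_le Fq P i).trans h3

theorem evalK_eq (P : Polynomial (Polynomial Fq)) (x : K Fq) :
    evalK Fq P x = (P.map (emb Fq)).eval x := by rw [evalK, eval_map]

theorem evalK_mul (P Q : Polynomial (Polynomial Fq)) (x : K Fq) :
    evalK Fq (P * Q) x = evalK Fq P x * evalK Fq Q x := by
  simp [evalK_eq]

theorem map_emb_ne_zero {P : Polynomial (Polynomial Fq)} (hP : P ≠ 0) : P.map (emb Fq) ≠ 0 :=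
  (Polynomial.map_ne_zero_iff (emb_injective Fq)).2 hP

theorem gauss_dvd {L : Type} [Field L] (f : Polynomial Fq →+* L) (hf : Function.Injective f)
    {P Q : Polynomial (Polynomial Fq)} (hP : Irreducible P) {x : L}
    (h1 : P.eval₂ f x = 0) (h2 : Q.eval₂ f x = 0) : P ∣ Q := by
  by_cases hQ : Q = 0
  · simp [hQ]
  have hdeg : P.natDegree ≠ 0 := by
    intro h
    rw [eq_C_of_natDegree_eq_zero h, eval₂_C] at h1
    have h3 := hf (h1.trans (map_zero f).symm)
    apply hP.ne_zero
    rw [eq_C_of_natDegree_eq_zero h, h3, C_0]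
  have hprim : P.IsPrimitive := hP.isPrimitive hdeg
  have hc : f Q.content ≠ 0 := fun h => by
    have := hf (h.trans (map_zero f).symm)
    exact hQ (content_eq_zero_iff.1 this)
  have h3 : Q.primPart.eval₂ f x = 0 := by
    rw [Q.eq_C_content_mul_primPart, eval₂_mul, eval₂_C] at h2
    exact (mul_eq_zero.1 h2).resolve_left hc
  suffices P ∣ Q.primPart from this.trans (Dvd.intro_left _ Q.eq_C_content_mul_primPart.symm)
  let F := FractionRing (Polynomial Fq)
  have hirr : Irreducible (P.map (algebraMap (Polynomial Fq) F)) :=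
    (hprim.irreducible_iff_irreducible_map_fraction_map).1 hP
  rw [IsPrimitive.dvd_iff_fraction_map_dvd_fraction_map F hprim]
  by_contra hnd
  have hcop := (hirr.coprime_iff_not_dvd).2 hnd
  let g : F →+* L := IsFractionRing.lift hf
  have hg : g.comp (algebraMap (Polynomial Fq) F) = f := by
    exact RingHom.ext fun y => IsFractionRing.lift_algebraMap hf y
  obtain ⟨a, b, hab⟩ := hcop
  have := congrArg (eval₂ g x) hab
  rw [eval₂_add, eval₂_mul, eval₂_mul, eval₂_map, eval₂_map, hg, h1, h3] at this
  simp at this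

theorem exists_irr {Q : Polynomial (Polynomial Fq)} (hQ : Q ≠ 0) {α : K Fq}
    (h : evalK Fq Q α = 0) : ∃ M, Irreducible M ∧ M ∣ Q ∧ evalK Fq M α = 0 := by
  induction Q using WfDvdMonoid.induction_on_irreducible with
  | zero => exact absurd rfl hQ
  | unit u hu =>
    exfalso
    obtain ⟨w, hw⟩ := hu.exists_right_inv
    have := evalK_mul Fq u w α
    rw [h, hw] at this
    simp [evalK] at this
  | mul a i ha hi ih =>
    rw [evalK_mul] at h
    rcases mul_eq_zero.1 h with h | h
    · exact ⟨i, hi, dvd_mul_right _ _, h⟩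
    · obtain ⟨M, h1, h2, h3⟩ := ih ha h
      exact ⟨M, h1, h2.mul_left _, h3⟩

theorem irr_dvd {M Q : Polynomial (Polynomial Fq)} (hM : Irreducible M) {α : K Fq}
    (h : evalK Fq M α = 0) (h' : evalK Fq Q α = 0) : M ∣ Q :=
  gauss_dvd Fq (emb Fq) (emb_injective Fq) hM h h'

theorem degA_le {Q : Polynomial (Polynomial Fq)} (hQ : Q ≠ 0) {α : K Fq}
    (h : evalK Fq Q α = 0) : degA Fq α ≤ Q.natDegree :=
  Nat.sInf_le ⟨Q, hQ, rfl, h⟩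

theorem degA_eq {M : Polynomial (Polynomial Fq)} (hM : Irreducible M) {α : K Fq}
    (h : evalK Fq M α = 0) : degA Fq α = M.natDegree := by
  apply le_antisymm (degA_le Fq hM.ne_zero h)
  refine le_csInf ⟨_, M, hM.ne_zero, rfl, h⟩ ?_
  rintro d ⟨Q, hQ, rfl, h'⟩
  exact natDegree_le_of_dvd (irr_dvd Fq hM h h') hQ

theorem HA_eq {M : Polynomial (Polynomial Fq)} (hM : Irreducible M) {α : K Fq}
    (h : evalK Fq M α = 0) : HA Fq α = HP Fq M := by
  have hmem : HP Fq M ∈ {h | ∃ P : Polynomial (Polynomial Fq),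
    P ≠ 0 ∧ P.natDegree = degA Fq α ∧ evalK Fq P α = 0 ∧ h = HP Fq P} :=
    ⟨M, hM.ne_zero, (degA_eq Fq hM h).symm, h, rfl⟩
  have hlb : ∀ b ∈ {h | ∃ P : Polynomial (Polynomial Fq),
    P ≠ 0 ∧ P.natDegree = degA Fq α ∧ evalK Fq P α = 0 ∧ h = HP Fq P}, HP Fq M ≤ b := by
    rintro _ ⟨Q, hQ, _, h', rfl⟩
    exact HP_le_of_dvd Fq (irr_dvd Fq hM h h') hQ
  exact le_antisymm (csInf_le ⟨_, hlb⟩ hmem) (le_csInf ⟨_, hmem⟩ hlb)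

theorem HA_le {Q : Polynomial (Polynomial Fq)} (hQ : Q ≠ 0) {α : K Fq}
    (h : evalK Fq Q α = 0) : 1 ≤ HA Fq α ∧ HA Fq α ≤ HP Fq Q := by
  obtain ⟨M, h1, h2, h3⟩ := exists_irr Fq hQ h
  rw [HA_eq Fq h1 h3]
  exact ⟨one_le_HP Fq M, HP_le_of_dvd Fq h2 hQ⟩

theorem finite_roots {Q : Polynomial (Polynomial Fq)} (hQ : Q ≠ 0) :
    {α : K Fq | evalK Fq Q α = 0}.Finite := by
  refine ((Q.map (emb Fq)).roots.toFinset.finite_toSet).subset ?_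
  intro α hα
  simp only [Set.mem_setOf_eq, evalK_eq] at hα
  simp [hα, map_emb_ne_zero Fq hQ]

/-- A convenient constant bounding `|ξ|`. -/
def cst (ξ : K Fq) : ℝ := max 1 (absK Fq ξ)

theorem one_le_cst (ξ : K Fq) : 1 ≤ cst Fq ξ := le_max_left _ _
theorem absK_le_cst (ξ : K Fq) : absK Fq ξ ≤ cst Fq ξ := le_max_right _ _

theorem absK_evalK_le_of_root (ξ α : K Fq) {P : Polynomial (Polynomial Fq)} {n : ℕ}
    (hn : P.natDegree ≤ n) (h : evalK Fq P α = 0) (hx : absK Fq (ξ - α) ≤ 1) :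
    absK Fq (evalK Fq P ξ) ≤ absK Fq (ξ - α) * (HP Fq P * cst Fq ξ ^ n) := by
  rw [evalK_eq] at h ⊢
  exact eval_le_of_root (absV Fq) ((natDegree_map_le).trans hn) (HP_pos Fq P).le
    (fun i => by rw [coeff_map]; exact absK_coeff_le Fq P i) (one_le_cst Fq ξ)
    (absK_le_cst Fq ξ) (isNonarch_absV Fq) h hx

theorem wn_ge_of (ξ : K Fq) (n : ℕ) {w : ℝ} (h : w ∈ wnSet Fq ξ n) : (w : EReal) ≤ wn Fq ξ n :=
  le_sSup ⟨w, h, rfl⟩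

theorem wnstar_ge_of (ξ : K Fq) (n : ℕ) {w : ℝ} (h : w ∈ wnstarSet Fq ξ n) :
    (w : EReal) ≤ wnstar Fq ξ n :=
  le_sSup ⟨w, h, rfl⟩

theorem ereal_le_of_forall (w₀ : ℝ) (x : EReal) (w : ℝ) (hw : w₀ < w)
    (h : ∀ w' : ℝ, w₀ < w' → w' < w → (w' : EReal) ≤ x) : (w : EReal) ≤ x := by
  by_contra hlt
  rw [not_le] at hlt
  obtain ⟨r, h1, h2⟩ := EReal.lt_iff_exists_real_btwn.1
    (max_lt hlt (EReal.coe_lt_coe_iff.2 hw))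
  have := h r (EReal.coe_lt_coe_iff.1 ((le_max_right _ _).trans_lt h1)) (EReal.coe_lt_coe_iff.1 h2)
  exact absurd (this.trans (le_max_left _ _)) (not_le.2 h1)

theorem natDegree_HP_C (k : ℕ) : HP Fq (C (X ^ k)) = (Fintype.card Fq : ℝ) ^ k := by
  rw [HP_eq_gn Fq (by simp), map_C, gn_C, absV_apply, absK_emb Fq (by simp)]
  simp

theorem wn_ge_neg_one (ξ : K Fq) (n : ℕ) : ((-1 : ℝ) : EReal) ≤ wn Fq ξ n := by
  apply ereal_le_of_forall (-2) _ _ (by norm_num)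
  intro w' _ hw'
  apply wn_ge_of
  have hinj : Function.Injective fun k : ℕ => (C (X ^ (k+1)) : Polynomial (Polynomial Fq)) := by
    intro a b hab
    have := congrArg natDegree (C_injective hab)
    simpa using this
  refine (Set.infinite_range_of_injective hinj).mono ?_
  rintro _ ⟨k, rfl⟩
  have hev : absK Fq (evalK Fq (C (X ^ (k+1))) ξ) = (Fintype.card Fq : ℝ) ^ (k+1) := by
    rw [evalK, eval₂_C, absK_emb Fq (by simp)]; simp
  have hq := q_gt_one Fq
  have h1 : (1:ℝ) < (Fintype.card Fq : ℝ) ^ (k+1) := one_lt_pow₀ hq (by simp)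
  refine ⟨by simp, by rw [hev]; positivity, ?_⟩
  rw [hev, natDegree_HP_C]
  conv_lhs => rw [← Real.rpow_one ((Fintype.card Fq : ℝ) ^ (k+1))]
  exact Real.rpow_lt_rpow_of_exponent_lt h1 (by linarith)

theorem infinite_of_unbounded (ξ : K Fq) (n : ℕ) (w : ℝ)
    (h : ∀ B : ℝ, ∃ P : Polynomial (Polynomial Fq), P.natDegree ≤ n ∧ B < HP Fq P ∧
      0 < absK Fq (evalK Fq P ξ) ∧ absK Fq (evalK Fq P ξ) < HP Fq P ^ (-w)) :
    w ∈ wnSet Fq ξ n := by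
  intro hfin
  obtain ⟨B, hB⟩ := (hfin.image (HP Fq)).bddAbove
  obtain ⟨P, h1, h2, h3, h4⟩ := h B
  exact absurd (hB ⟨P, ⟨h1, h3, h4⟩, rfl⟩) (not_le.2 h2)

/-- For large `H`, a constant is beaten by a negative power. -/
theorem exists_beats (C ε : ℝ) (hε : 0 < ε) : ∃ B : ℝ, 1 ≤ B ∧ ∀ H, B < H → C * H ^ (-ε) < 1 := by
  have h := (tendsto_rpow_neg_atTop hε).const_mul C
  rw [mul_zero] at h
  obtain ⟨B, hB⟩ := Filter.eventually_atTop.1 (h.eventually (gt_mem_nhds zero_lt_one))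
  exact ⟨max 1 B, le_max_left _ _, fun H hH => hB H ((le_max_right _ _).trans hH.le)⟩

theorem wnstar_le_wn (ξ : K Fq) (n : ℕ) : wnstar Fq ξ n ≤ wn Fq ξ n := by
  apply sSup_le
  rintro _ ⟨w, hw, rfl⟩
  by_cases hw1 : w ≤ -1
  · exact (EReal.coe_le_coe_iff.2 hw1).trans (wn_ge_neg_one Fq ξ n)
  push Not at hw1
  apply ereal_le_of_forall (-1) _ _ hw1
  intro w' _ hw'
  apply wn_ge_of
  apply infinite_of_unbounded
  intro B
  obtain ⟨B', hB'1, hB'⟩ := exists_beats (cst Fq ξ ^ n) (w - w') (by linarith)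
  -- the bad set
  have hfin0 : {α : K Fq | ∃ P : Polynomial (Polynomial Fq), (P.natDegree ≤ n ∧
      HP Fq P ≤ max B B') ∧ P ≠ 0 ∧ evalK Fq P α = 0}.Finite := by
    have : {α : K Fq | ∃ P : Polynomial (Polynomial Fq), (P.natDegree ≤ n ∧
      HP Fq P ≤ max B B') ∧ P ≠ 0 ∧ evalK Fq P α = 0} ⊆
      ⋃ P ∈ {P : Polynomial (Polynomial Fq) | P.natDegree ≤ n ∧ HP Fq P ≤ max B B'},
        {α : K Fq | P ≠ 0 ∧ evalK Fq P α = 0} := by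
      rintro α ⟨P, h1, h2, h3⟩
      simp only [Set.mem_iUnion]
      exact ⟨P, h1, h2, h3⟩
    refine Set.Finite.subset (Set.Finite.biUnion (finite_HP_le Fq n _) ?_) this
    intro P _
    by_cases hP : P = 0
    · simp [hP]
    · exact (finite_roots Fq hP).subset fun α h => h.2
  have hfin1 : {α : K Fq | ∃ P : Polynomial (Polynomial Fq), Irreducible P ∧
      evalK Fq P α = 0 ∧ evalK Fq P ξ = 0}.Finite := by
    by_cases hξ : IsAlgK Fq ξ
    · obtain ⟨M, hM, hM0⟩ := hξ
      refine (finite_roots Fq hM).subset ?_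
      rintro α ⟨P, h1, h2, h3⟩
      obtain ⟨R, rfl⟩ := irr_dvd Fq h1 h3 hM0
      simp [evalK_mul, h2]
    · convert Set.finite_empty
      ext α
      simp only [Set.mem_setOf_eq, Set.mem_empty_iff_false, iff_false]
      rintro ⟨P, h1, h2, h3⟩
      exact hξ ⟨P, h1.ne_zero, h3⟩
  obtain ⟨α, ⟨⟨Q, hQ, hQ0⟩, hd, hpos, hlt⟩, hα⟩ := (hw.diff (hfin0.union hfin1)).nonempty
  obtain ⟨M, hM, -, hM0⟩ := exists_irr Fq hQ hQ0
  rw [degA_eq Fq hM hM0] at hd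
  rw [HA_eq Fq hM hM0] at hlt
  simp only [Set.mem_union, not_or, Set.mem_setOf_eq, not_exists, not_and] at hα
  have hB : max B B' < HP Fq M := by
    by_contra hle
    exact hα.1 M ⟨hd, not_lt.1 hle⟩ hM.ne_zero hM0
  have hne : evalK Fq M ξ ≠ 0 := fun h => hα.2 M hM hM0 h
  refine ⟨M, hd, (le_max_left _ _).trans_lt hB, absK_pos Fq hne, ?_⟩
  have h1 : absK Fq (ξ - α) ≤ 1 :=
    hlt.le.trans (Real.rpow_le_one_of_one_le_of_nonpos (one_le_HP Fq M) (by linarith))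
  have hH := HP_pos Fq M
  have hc := one_le_cst Fq ξ
  calc absK Fq (evalK Fq M ξ) ≤ absK Fq (ξ - α) * (HP Fq M * cst Fq ξ ^ n) :=
        absK_evalK_le_of_root Fq ξ α hd hM0 h1
    _ < HP Fq M ^ (-w - 1) * (HP Fq M * cst Fq ξ ^ n) := by
        apply mul_lt_mul_of_pos_right hlt; positivity
    _ = (cst Fq ξ ^ n * HP Fq M ^ (-(w - w'))) * HP Fq M ^ (-w') := by
        have : HP Fq M ^ (-w - 1) * HP Fq M = HP Fq M ^ (-(w - w')) * HP Fq M ^ (-w') := by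
          rw [← Real.rpow_add hH, ← Real.rpow_add_one hH.ne']; ring_nf
        linear_combination cst Fq ξ ^ n * this
    _ ≤ 1 * HP Fq M ^ (-w') := by
        apply mul_le_mul_of_nonneg_right (hB' _ ((le_max_right _ _).trans_lt hB)).le
        positivity
    _ = _ := one_mul _

theorem exists_intPart (η : K Fq) : ∃ A : Polynomial Fq, absK Fq (η - emb Fq A) < 1 := by
  obtain ⟨N, hN⟩ : ∃ N : ℕ, ∀ m : ℤ, m < -N → η.coeff m = 0 := by
    refine ⟨(-η.order).toNat, fun m hm => HahnSeries.coeff_eq_zero_of_lt_order ?_⟩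
    omega
  refine ⟨∑ i ∈ Finset.range (N+1), monomial i (η.coeff (-(i:ℤ))), ?_⟩
  have h : absK Fq (η - emb Fq (∑ i ∈ Finset.range (N+1), monomial i (η.coeff (-(i:ℤ))))) ≤
      (Fintype.card Fq : ℝ) ^ (-(1:ℤ)) := by
    rw [absK_le_iff]
    intro m hm
    rw [HahnSeries.coeff_sub, coeff_emb, if_pos (by omega), finsetSum_coeff]
    simp only [coeff_monomial]
    rw [Finset.sum_ite_eq' (Finset.range (N+1)) (-m).toNat]
    split_ifs with h1
    · rw [show (-((-m).toNat : ℤ)) = m by omega, sub_self]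
    · rw [Finset.mem_range] at h1
      rw [hN m (by omega), sub_zero]
  refine h.trans_lt ?_
  rw [zpow_neg_one]
  exact inv_lt_one_of_one_lt₀ (q_gt_one Fq)

theorem HP_le {P : Polynomial (Polynomial Fq)} (hP : P ≠ 0) {B : ℝ}
    (h : ∀ i, absK Fq (emb Fq (P.coeff i)) ≤ B) : HP Fq P ≤ B := by
  rw [HP_eq_gn Fq hP]
  apply gn_le
  intro i; rw [coeff_map]; exact h i

theorem wnstar_nonneg (ξ : K Fq) (n : ℕ) (hn : 1 ≤ n) : ((0 : ℝ) : EReal) ≤ wnstar Fq ξ n := by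
  apply ereal_le_of_forall (-1) _ _ (by norm_num)
  intro w hw1 hw0
  apply wnstar_ge_of
  have hq := q_gt_one Fq
  have hc := one_le_cst Fq ξ
  obtain ⟨B, hB1, hB⟩ := exists_beats (cst Fq ξ ^ (w+1)) (-w) (by linarith)
  obtain ⟨k₀, hk₀⟩ := pow_unbounded_of_one_lt B hq
  have key : ∀ k : ℕ, ∃ α : K Fq, absK Fq (ξ - α) = ((Fintype.card Fq : ℝ) ^ k)⁻¹ ∧
      IsAlgK Fq α ∧ degA Fq α ≤ n ∧ 1 ≤ HA Fq α ∧
      HA Fq α ≤ cst Fq ξ * (Fintype.card Fq : ℝ) ^ k := by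
    intro k
    have hT : absK Fq (emb Fq (X ^ k)) = (Fintype.card Fq : ℝ) ^ k := by
      rw [absK_emb Fq (by simp)]; simp
    have hT0 : emb Fq (X ^ k) ≠ 0 := (map_ne_zero_iff _ (emb_injective Fq)).2 (by simp)
    obtain ⟨A, hA⟩ := exists_intPart Fq (emb Fq (X ^ k) * ξ)
    have hk1 : (1:ℝ) ≤ (Fintype.card Fq : ℝ) ^ k := one_le_pow₀ hq.le
    have h1 : absK Fq (emb Fq (X ^ k) * ξ - emb Fq (A + 1)) = 1 := by
      have h2 : emb Fq (X ^ k) * ξ - emb Fq (A + 1) =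
        (emb Fq (X ^ k) * ξ - emb Fq A) + (-1) := by rw [map_add, map_one]; ring
      have hm1 : absK Fq (-1 : K Fq) = 1 := by rw [absK_neg, absK_one]
      apply le_antisymm
      · rw [h2]
        refine (absK_add_le Fq _ _).trans (max_le hA.le hm1.le)
      · have h3 : (-1 : K Fq) = (emb Fq (X ^ k) * ξ - emb Fq (A + 1)) +
          -(emb Fq (X ^ k) * ξ - emb Fq A) := by rw [h2]; ring
        have h4 := absK_add_le Fq (emb Fq (X ^ k) * ξ - emb Fq (A + 1))
          (-(emb Fq (X ^ k) * ξ - emb Fq A))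
        rw [← h3, hm1, absK_neg] at h4
        rcases le_max_iff.1 h4 with h | h
        · exact h
        · exact absurd h (not_le.2 hA)
    have hAle : absK Fq (emb Fq (A + 1)) ≤ cst Fq ξ * (Fintype.card Fq : ℝ) ^ k := by
      have h3 : emb Fq (A + 1) = emb Fq (X ^ k) * ξ + -(emb Fq (X ^ k) * ξ - emb Fq (A + 1)) := by
        ring
      rw [h3]
      refine (absK_add_le Fq _ _).trans (max_le ?_ ?_)
      · rw [absK_mul, hT, mul_comm]
        exact mul_le_mul_of_nonneg_right (absK_le_cst Fq ξ) (by positivity)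
      · rw [absK_neg, h1]; exact one_le_mul_of_one_le_of_one_le hc hk1
    set P : Polynomial (Polynomial Fq) := C (X ^ k) * X + C (-(A + 1)) with hP
    have hP0 : P ≠ 0 := by
      intro h
      have h6 : P.coeff 1 = 0 := by rw [h, coeff_zero]
      rw [hP, coeff_add, coeff_C_mul, coeff_X_one, coeff_C_succ] at h6
      simp at h6
    have hroot : evalK Fq P (emb Fq (A + 1) / emb Fq (X ^ k)) = 0 := by
      rw [hP, evalK, eval₂_add, eval₂_mul, eval₂_C, eval₂_C, eval₂_X, map_neg]
      field_simp
      ring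
    have hHP : HP Fq P ≤ cst Fq ξ * (Fintype.card Fq : ℝ) ^ k := by
      apply HP_le Fq hP0
      intro i
      rcases i with _ | _ | i
      · simp only [hP, coeff_add, coeff_C_mul, coeff_X_zero, mul_zero, coeff_C_zero, zero_add]
        rw [map_neg, absK_neg]; exact hAle
      · simp only [hP, coeff_add, coeff_C_mul, zero_add, coeff_X_one, mul_one, coeff_C_succ, add_zero]
        rw [hT]; exact le_mul_of_one_le_left (by positivity) hc
      · have : P.coeff (i + 1 + 1) = 0 := by
          apply coeff_eq_zero_of_natDegree_lt
          have := natDegree_linear_le (a := (X ^ k : Polynomial Fq)) (b := -(A+1))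
          rw [← hP] at this
          omega
        rw [this, map_zero, absK_zero]; positivity
    have hHA := HA_le Fq hP0 hroot
    refine ⟨_, ?_, ⟨P, hP0, hroot⟩, (degA_le Fq hP0 hroot).trans
      (natDegree_linear_le.trans hn), hHA.1, hHA.2.trans hHP⟩
    have h5 : emb Fq (X ^ k) * (ξ - emb Fq (A + 1) / emb Fq (X ^ k)) =
        emb Fq (X ^ k) * ξ - emb Fq (A + 1) := by field_simp
    rw [← h5, absK_mul, hT] at h1
    exact eq_inv_of_mul_eq_one_right h1
  choose α h1 h2 h3 h4 h5 using key
  have hinj : Function.Injective fun k : ℕ => α (k + k₀) := by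
    intro a b hab
    have := (h1 (a + k₀)).symm.trans ((congrArg (fun z => absK Fq (ξ - z)) hab).trans (h1 (b + k₀)))
    have := pow_right_injective₀ (q_pos Fq) hq.ne' (inv_injective this)
    omega
  refine (Set.infinite_range_of_injective hinj).mono ?_
  rintro _ ⟨k, rfl⟩
  refine ⟨h2 _, h3 _, by rw [h1]; have := q_pos Fq; positivity, ?_⟩
  rw [h1]
  set H := (Fintype.card Fq : ℝ) ^ (k + k₀) with hH
  have hBH : B < H := hk₀.trans_le (pow_le_pow_right₀ hq.le (by omega))
  have hHpos : 0 < H := by linarith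
  have hHA0 : 0 < HA Fq (α (k + k₀)) := by linarith [h4 (k + k₀)]
  have hb := hB H hBH
  have e1 : HA Fq (α (k + k₀)) ^ (-w - 1) = (HA Fq (α (k + k₀)) ^ (w + 1))⁻¹ := by
    rw [← Real.rpow_neg hHA0.le]; ring_nf
  rw [e1]
  apply inv_strictAnti₀ (by positivity)
  calc HA Fq (α (k + k₀)) ^ (w + 1) ≤ (cst Fq ξ * H) ^ (w + 1) :=
        Real.rpow_le_rpow hHA0.le (h5 _) (by linarith)
    _ = (cst Fq ξ ^ (w+1) * H ^ (-(-w))) * H := by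
        rw [Real.mul_rpow (by linarith) hHpos.le, mul_assoc, ← Real.rpow_add_one hHpos.ne']
        ring_nf
    _ < 1 * H := mul_lt_mul_of_pos_right hb hHpos
    _ = H := one_mul H

theorem dirichlet (ξ : K Fq) (n : ℕ) : ∃ D : ℝ, 0 < D ∧ ∀ h : ℕ, 1 ≤ h →
    ∃ Q : Polynomial (Polynomial Fq), Q ≠ 0 ∧ Q.natDegree ≤ n ∧
      HP Fq Q < (Fintype.card Fq : ℝ) ^ h ∧
      absK Fq (evalK Fq Q ξ) ≤ D * ((Fintype.card Fq : ℝ) ^ (n * h))⁻¹ := by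
  have hq := q_gt_one Fq
  have hq0 := q_pos Fq
  obtain ⟨s, hs⟩ := pow_unbounded_of_one_lt (cst Fq ξ) hq
  refine ⟨(Fintype.card Fq : ℝ) ^ (n * s), by positivity, fun h hh => ?_⟩
  let lin : (Fin (n+1) × Fin h → Fq) →ₗ[Fq] K Fq :=
    Fintype.linearCombination Fq fun p => Tvar Fq ^ (p.2 : ℕ) * ξ ^ (p.1 : ℕ)
  let φ : (Fin (n+1) × Fin h → Fq) →ₗ[Fq] (Fin ((n+1)*h - 1) → Fq) :=
    { toFun := fun c k => (lin c).coeff ((k : ℤ) - ((h - 1 + n * s : ℕ) : ℤ))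
      map_add' := fun a b => by ext k; simp [HahnSeries.coeff_add]
      map_smul' := fun a b => by ext k; simp [HahnSeries.coeff_smul] }
  have hker : LinearMap.ker φ ≠ ⊥ := by
    apply LinearMap.ker_ne_bot_of_finrank_lt
    simp only [Module.finrank_fintype_fun_eq_card, Fintype.card_prod, Fintype.card_fin]
    have : 0 < (n+1) * h := by positivity
    omega
  obtain ⟨c, hc, hc0⟩ := (Submodule.ne_bot_iff _).1 hker
  let Q : Polynomial (Polynomial Fq) := ∑ p : Fin (n+1) × Fin h, monomial p.1 (monomial p.2 (c p))
  have hcoef : ∀ i, (Q.coeff i) = ∑ p : Fin (n+1) × Fin h, if (p.1 : ℕ) = i then monomial p.2 (c p) else 0 := by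
    intro i
    simp only [Q, finsetSum_coeff, coeff_monomial]
  have hQ0 : Q ≠ 0 := by
    obtain ⟨p, hp⟩ := Function.ne_iff.1 hc0
    intro h0
    apply hp
    have h1 := hcoef p.1
    rw [h0, coeff_zero] at h1
    have h2 := congrArg (fun r => r.coeff (p.2 : ℕ)) h1
    simp only [coeff_zero, finsetSum_coeff] at h2
    rw [Finset.sum_eq_single p] at h2
    · simpa [coeff_monomial] using h2.symm
    · intro b _ hb
      split_ifs with h3
      · rw [coeff_monomial, if_neg]
        intro h4
        exact hb (Prod.ext (Fin.ext h3) (Fin.ext h4))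
      · simp
    · simp
  have hdeg : Q.natDegree ≤ n := by
    apply natDegree_sum_le_of_forall_le
    intro p _
    exact (natDegree_monomial_le _).trans (by have := p.1.2; omega)
  have hcd : ∀ i, (Q.coeff i).natDegree ≤ h - 1 := by
    intro i
    rw [hcoef]
    apply natDegree_sum_le_of_forall_le
    intro p _
    split_ifs
    · exact (natDegree_monomial_le _).trans (by have := p.2.2; omega)
    · simp
  have hHP : HP Fq Q ≤ (Fintype.card Fq : ℝ) ^ (h - 1) :=
    pow_le_pow_right₀ hq.le (Finset.sup_le fun i _ => hcd i)
  have hev : evalK Fq Q ξ = lin c := by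
    simp only [evalK, Q, eval₂_finsetSum, eval₂_monomial, lin, Fintype.linearCombination_apply]
    apply Finset.sum_congr rfl
    intro p _
    rw [emb, coe_eval₂RingHom, eval₂_monomial, mul_assoc]
    rw [LaurentSeries.algebraMap_apply, HahnSeries.C_mul_eq_smul]
  refine ⟨Q, hQ0, hdeg, hHP.trans_lt (pow_lt_pow_right₀ hq (by omega)), ?_⟩
  have hbig : absK Fq (evalK Fq Q ξ) ≤ (Fintype.card Fq : ℝ) ^ (-(-((h - 1 + n * s : ℕ) : ℤ))) := by
    rw [evalK_eq]
    refine (eval_le (absV Fq) (natDegree_map_le.trans hdeg) (HP_pos Fq Q).le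
      (fun i => by rw [coeff_map]; exact absK_coeff_le Fq Q i) (one_le_cst Fq ξ)
      (absK_le_cst Fq ξ) (isNonarch_absV Fq)).trans ?_
    rw [neg_neg, zpow_natCast, pow_add, mul_comm n s, pow_mul]
    have := one_le_cst Fq ξ
    apply mul_le_mul hHP (pow_le_pow_left₀ (by linarith) hs.le _) (by positivity) (by positivity)
  rw [absK_le_iff] at hbig
  have hgoal : absK Fq (evalK Fq Q ξ) ≤ (Fintype.card Fq : ℝ) ^ (-((n * h : ℕ) - (n * s : ℕ) : ℤ)) := by
    rw [absK_le_iff]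
    intro m hm
    by_cases hm' : m < -((h - 1 + n * s : ℕ) : ℤ)
    · exact hbig m hm'
    · have h1 : φ c = 0 := hc
      have hlt : (m + ((h - 1 + n * s : ℕ) : ℤ)).toNat < (n+1)*h - 1 := by
        have : (n+1)*h = n*h + h := by ring
        omega
      have h2 := congrFun h1 ⟨_, hlt⟩
      simp only [φ, LinearMap.coe_mk, AddHom.coe_mk, Pi.zero_apply] at h2
      rw [hev, ← h2]
      congr 1
      omega
  refine hgoal.trans (le_of_eq ?_)
  rw [neg_sub, zpow_sub₀ hq0.ne', zpow_natCast, zpow_natCast]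
  rfl

section multi

def dprod (A B : Multiset ℝ) : ℝ := (A.map fun a => (B.map fun b => max a b).prod).prod

def gg (A : Multiset ℝ) : ℝ := (A.map fun a => max 1 a).prod

def RR (la lb : ℝ) (A B : Multiset ℝ) : ℝ :=
  la ^ Multiset.card B * lb ^ Multiset.card A * dprod A B

theorem dprod_comm (A B : Multiset ℝ) : dprod A B = dprod B A := by
  unfold dprod
  rw [Multiset.prod_map_prod_map]
  simp only [max_comm]

theorem RR_comm (la lb : ℝ) (A B : Multiset ℝ) : RR la lb A B = RR lb la B A := by
  unfold RR
  rw [dprod_comm]; ring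

theorem dprod_cons (a : ℝ) (A B : Multiset ℝ) :
    dprod (a ::ₘ A) B = (B.map fun b => max a b).prod * dprod A B := by
  simp [dprod]

theorem dprod_cons_right (b : ℝ) (A B : Multiset ℝ) :
    dprod A (b ::ₘ B) = (A.map fun a => max a b).prod * dprod A B := by
  rw [dprod_comm, dprod_cons, dprod_comm B A]
  simp only [max_comm]

theorem gg_cons (a : ℝ) (A : Multiset ℝ) : gg (a ::ₘ A) = max 1 a * gg A := by simp [gg]

theorem one_le_gg (A : Multiset ℝ) : 1 ≤ gg A := by
  induction A using Multiset.induction_on with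
  | empty => simp [gg]
  | cons a A ih => rw [gg_cons]; exact one_le_mul_of_one_le_of_one_le (le_max_left _ _) ih

theorem dprod_nonneg (A B : Multiset ℝ) (hB : ∀ b ∈ B, 0 ≤ b) : 0 ≤ dprod A B := by
  apply Multiset.prod_nonneg
  intro z hz
  obtain ⟨a, _, rfl⟩ := Multiset.mem_map.1 hz
  apply Multiset.prod_nonneg
  intro y hy
  obtain ⟨b, hb, rfl⟩ := Multiset.mem_map.1 hy
  exact (hB b hb).trans (le_max_right _ _)

theorem row_le' (a : ℝ) (B : Multiset ℝ) (hB : ∀ b ∈ B, 0 ≤ b) :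
    (B.map fun b => max a b).prod ≤ max 1 a ^ Multiset.card B * gg B := by
  induction B using Multiset.induction_on with
  | empty => simp [gg]
  | cons b B ih =>
    rw [Multiset.map_cons, Multiset.prod_cons, gg_cons, Multiset.card_cons, pow_succ]
    have h1 : max a b ≤ max 1 a * max 1 b := by
      have x1 := le_max_left 1 a
      have x2 := le_max_left 1 b
      have x3 := le_max_right 1 a
      have x4 := le_max_right 1 b
      apply max_le <;> nlinarith
    have h2 : 0 ≤ (B.map fun b => max a b).prod := by
      apply Multiset.prod_nonneg
      intro y hy
      obtain ⟨b, hb, rfl⟩ := Multiset.mem_map.1 hy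
      exact (hB b (Multiset.mem_cons_of_mem hb)).trans (le_max_right _ _)
    have h3 := mul_le_mul h1 (ih fun b hb => hB b (Multiset.mem_cons_of_mem hb)) h2 (by positivity)
    linarith

theorem dprod_le (A B : Multiset ℝ) (hB : ∀ b ∈ B, 0 ≤ b) :
    dprod A B ≤ gg A ^ Multiset.card B * gg B ^ Multiset.card A := by
  induction A using Multiset.induction_on with
  | empty => simp [dprod, gg]
  | cons a A ih =>
    rw [dprod_cons, gg_cons, Multiset.card_cons, pow_succ, mul_pow]
    have g1 := one_le_gg B
    have h3 := mul_le_mul (row_le' a B hB) ih (dprod_nonneg A B hB) (by positivity)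
    linarith

theorem row_eq (a : ℝ) (B : Multiset ℝ) (h : ∀ b ∈ B, a ≤ b) :
    (B.map fun b => max a b).prod = B.prod := by
  rw [Multiset.map_congr rfl (fun b hb => max_eq_right (h b hb)), Multiset.map_id']

theorem col_eq (b : ℝ) (A : Multiset ℝ) (h : ∀ a ∈ A, b ≤ a) :
    (A.map fun a => max a b).prod = A.prod := by
  rw [Multiset.map_congr rfl (fun a ha => max_eq_left (h a ha)), Multiset.map_id']

theorem RR_pair {la lb : ℝ} (hla : 1 ≤ la) (hlb : 1 ≤ lb) (a₁ a₂ : ℝ) (A B : Multiset ℝ)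
    (hB : ∀ b ∈ B, 0 ≤ b) (h1 : ∀ b ∈ B, a₁ ≤ b) (h2 : ∀ b ∈ B, a₂ ≤ b) :
    RR la lb (a₁ ::ₘ a₂ ::ₘ A) B ≤ (lb * B.prod) ^ 2 *
      ((la * gg (a₁ ::ₘ a₂ ::ₘ A)) ^ Multiset.card B * (lb * gg B) ^ Multiset.card A) := by
  have hP : 0 ≤ B.prod := Multiset.prod_nonneg hB
  rw [RR, dprod_cons, dprod_cons, row_eq _ _ h1, row_eq _ _ h2]
  simp only [Multiset.card_cons]
  have g1 := one_le_gg A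
  have g2 : gg A ≤ gg (a₁ ::ₘ a₂ ::ₘ A) := by
    rw [gg_cons, gg_cons]
    have x1 := le_max_left 1 a₁
    have x2 := le_max_left 1 a₂
    exact (le_mul_of_one_le_left (by linarith) x2).trans
      (le_mul_of_one_le_left (by positivity) x1)
  have h3 : dprod A B ≤ gg (a₁ ::ₘ a₂ ::ₘ A) ^ Multiset.card B * gg B ^ Multiset.card A :=
    (dprod_le A B hB).trans (mul_le_mul_of_nonneg_right
      (pow_le_pow_left₀ (by linarith) g2 _) (by have := one_le_gg B; positivity))
  have h4 := mul_le_mul_of_nonneg_left h3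
    (show 0 ≤ la ^ Multiset.card B * lb ^ (Multiset.card A + 1 + 1) * (B.prod * B.prod) by positivity)
  calc _ = la ^ Multiset.card B * lb ^ (Multiset.card A + 1 + 1) * (B.prod * B.prod) * dprod A B := by ring
    _ ≤ _ := h4
    _ = _ := by rw [mul_pow, mul_pow, mul_pow]; ring

theorem RR_single {la lb : ℝ} (hla : 1 ≤ la) (hlb : 1 ≤ lb) (a₁ b₁ : ℝ) (A B : Multiset ℝ)
    (ha : 0 ≤ a₁) (hA : ∀ a ∈ A, 0 ≤ a) (hB : ∀ b ∈ b₁ ::ₘ B, 0 ≤ b)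
    (h1 : ∀ b ∈ b₁ ::ₘ B, a₁ ≤ b) (h2 : ∀ a ∈ A, b₁ ≤ a) :
    a₁ * RR la lb (a₁ ::ₘ A) (b₁ ::ₘ B) ≤
      (la * (a₁ ::ₘ A).prod) * (lb * (b₁ ::ₘ B).prod) *
      ((la * gg (a₁ ::ₘ A)) ^ Multiset.card B * (lb * gg (b₁ ::ₘ B)) ^ Multiset.card A) := by
  have hP : 0 ≤ (b₁ ::ₘ B).prod := Multiset.prod_nonneg hB
  have hPA : 0 ≤ A.prod := Multiset.prod_nonneg hA
  rw [RR, dprod_cons, row_eq _ _ h1, dprod_cons_right, col_eq _ _ h2, Multiset.prod_cons a₁]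
  simp only [Multiset.card_cons]
  have gA := one_le_gg A
  have gB := one_le_gg B
  have g2 : gg A ≤ gg (a₁ ::ₘ A) := by
    rw [gg_cons]; exact le_mul_of_one_le_left (by linarith) (le_max_left _ _)
  have g3 : gg B ≤ gg (b₁ ::ₘ B) := by
    rw [gg_cons]; exact le_mul_of_one_le_left (by linarith) (le_max_left _ _)
  have h3 : dprod A B ≤ gg (a₁ ::ₘ A) ^ Multiset.card B * gg (b₁ ::ₘ B) ^ Multiset.card A :=
    (dprod_le A B fun b hb => hB b (Multiset.mem_cons_of_mem hb)).trans
      (mul_le_mul (pow_le_pow_left₀ (by linarith) g2 _) (pow_le_pow_left₀ (by linarith) g3 _)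
        (by positivity) (pow_nonneg (by linarith) _))
  have h4 := mul_le_mul_of_nonneg_left h3
    (show 0 ≤ a₁ * la ^ (Multiset.card B + 1) * lb ^ (Multiset.card A + 1) *
      ((b₁ ::ₘ B).prod * A.prod) by positivity)
  calc _ = a₁ * la ^ (Multiset.card B + 1) * lb ^ (Multiset.card A + 1) *
      ((b₁ ::ₘ B).prod * A.prod) * dprod A B := by ring
    _ ≤ _ := h4
    _ = _ := by rw [mul_pow, mul_pow]; ring

theorem RR_zero {la lb : ℝ} (hla : 1 ≤ la) (hlb : 1 ≤ lb) (A B : Multiset ℝ)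
    (hA : ∀ a ∈ A, 0 ≤ a) (hB : ∀ b ∈ B, 0 ≤ b) :
    RR la lb A (0 ::ₘ B) ≤ (la * A.prod) *
      ((la * gg A) ^ Multiset.card B * (lb * gg (0 ::ₘ B)) ^ Multiset.card A) := by
  have hPA : 0 ≤ A.prod := Multiset.prod_nonneg hA
  rw [RR, dprod_cons_right, col_eq _ _ hA]
  have e : gg (0 ::ₘ B) = gg B := by rw [gg_cons]; simp
  rw [e, Multiset.card_cons]
  have h4 := mul_le_mul_of_nonneg_left (dprod_le A B hB)
    (show 0 ≤ la ^ (Multiset.card B + 1) * lb ^ (Multiset.card A) * A.prod by positivity)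
  calc _ = la ^ (Multiset.card B + 1) * lb ^ (Multiset.card A) * A.prod * dprod A B := by ring
    _ ≤ _ := h4
    _ = _ := by rw [mul_pow, mul_pow]; ring

theorem exists_min_mem {A : Multiset ℝ} (h : A ≠ 0) : ∃ a ∈ A, ∀ b ∈ A, a ≤ b := by
  obtain ⟨a, ha, hm⟩ := A.toFinset.exists_min_image id (by simpa [Finset.nonempty_iff_ne_empty] using h)
  exact ⟨a, by simpa using ha, fun b hb => hm b (by simpa using hb)⟩

end multi

/-- The extended absolute value on the algebraic closure. -/
def vv : AbsoluteValue (Kbar Fq) ℝ := Classical.choose (exists_ext Fq)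

theorem vv_na : IsNonarchimedean (vv Fq) := (Classical.choose_spec (exists_ext Fq)).1

theorem vv_alg (x : K Fq) : vv Fq (algebraMap (K Fq) (Kbar Fq) x) = absK Fq x :=
  (Classical.choose_spec (exists_ext Fq)).2.1 x

theorem vv_minpoly {x y : Kbar Fq} (h : minpoly (K Fq) x = minpoly (K Fq) y) :
    vv Fq x = vv Fq y := (Classical.choose_spec (exists_ext Fq)).2.2 x y h

theorem embbar_injective : Function.Injective (embbar Fq) :=
  (algebraMap (K Fq) (Kbar Fq)).injective.comp (emb_injective Fq)

theorem vv_embbar (r : Polynomial Fq) : vv Fq (embbar Fq r) = absK Fq (emb Fq r) :=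
  vv_alg Fq _

/-- The polynomial over the algebraic closure. -/
def bar (P : Polynomial (Polynomial Fq)) : (Kbar Fq)[X] := P.map (embbar Fq)

theorem bar_eq (P : Polynomial (Polynomial Fq)) :
    bar Fq P = (P.map (emb Fq)).map (algebraMap (K Fq) (Kbar Fq)) := by
  rw [bar, embbar, Polynomial.map_map]

theorem bar_ne_zero {P : Polynomial (Polynomial Fq)} (hP : P ≠ 0) : bar Fq P ≠ 0 :=
  (Polynomial.map_ne_zero_iff (embbar_injective Fq)).2 hP

theorem bar_natDegree (P : Polynomial (Polynomial Fq)) : (bar Fq P).natDegree = P.natDegree :=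
  natDegree_map_eq_of_injective (embbar_injective Fq) P

theorem bar_splits (P : Polynomial (Polynomial Fq)) : (bar Fq P).Splits :=
  IsAlgClosed.splits _

/-- Distances from `ξ` to the roots of `P`. -/
def rts (ξ : K Fq) (P : Polynomial (Polynomial Fq)) : Multiset ℝ :=
  (bar Fq P).roots.map fun a => vv Fq (algebraMap (K Fq) (Kbar Fq) ξ - a)

def lcv (P : Polynomial (Polynomial Fq)) : ℝ := vv Fq (bar Fq P).leadingCoeff

theorem one_le_lcv {P : Polynomial (Polynomial Fq)} (hP : P ≠ 0) : 1 ≤ lcv Fq P := by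
  rw [lcv, bar, leadingCoeff_map_of_injective (embbar_injective Fq), vv_embbar]
  exact one_le_absK_emb Fq (leadingCoeff_ne_zero.2 hP)

theorem rts_nonneg (ξ : K Fq) (P : Polynomial (Polynomial Fq)) : ∀ a ∈ rts Fq ξ P, 0 ≤ a := by
  intro a ha
  obtain ⟨z, _, rfl⟩ := Multiset.mem_map.1 ha
  exact (vv Fq).nonneg _

theorem card_rts (ξ : K Fq) (P : Polynomial (Polynomial Fq)) :
    Multiset.card (rts Fq ξ P) = P.natDegree := by
  rw [rts, Multiset.card_map, ← (bar_splits Fq P).natDegree_eq_card_roots, bar_natDegree]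

theorem bar_eval (ξ : K Fq) (P : Polynomial (Polynomial Fq)) :
    (bar Fq P).eval (algebraMap (K Fq) (Kbar Fq) ξ) = algebraMap (K Fq) (Kbar Fq) (evalK Fq P ξ) := by
  rw [bar_eq, eval_map_algebraMap, aeval_algebraMap_apply, evalK_eq]; simp

theorem vv_eval (P : Polynomial (Polynomial Fq)) (x : Kbar Fq) :
    vv Fq ((bar Fq P).eval x) = lcv Fq P * ((bar Fq P).roots.map fun a => vv Fq (x - a)).prod := by
  conv_lhs => rw [(bar_splits Fq P).eq_prod_roots]
  rw [eval_mul, eval_C, eval_multiset_prod, map_mul, map_multiset_prod, Multiset.map_map,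
    Multiset.map_map, lcv]
  congr 2
  apply Multiset.map_congr rfl
  intro a _
  simp

theorem lcv_prod (ξ : K Fq) (P : Polynomial (Polynomial Fq)) :
    lcv Fq P * (rts Fq ξ P).prod = absK Fq (evalK Fq P ξ) := by
  rw [← vv_alg, ← bar_eval, vv_eval, rts]

theorem lcv_gg_le (ξ : K Fq) {P : Polynomial (Polynomial Fq)} {n : ℕ} (hn : P.natDegree ≤ n) :
    lcv Fq P * gg (rts Fq ξ P) ≤ HP Fq P * cst Fq ξ ^ n := by
  have h := mahler_le (vv Fq) (bar_splits Fq P) ((bar_natDegree Fq P).le.trans hn)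
    (HP_pos Fq P).le (fun i => by
      rw [bar, coeff_map, vv_embbar]; exact absK_coeff_le Fq P i) (one_le_cst Fq ξ)
    (x := algebraMap (K Fq) (Kbar Fq) ξ) (by rw [vv_alg]; exact absK_le_cst Fq ξ) (vv_na Fq)
  rw [gg, rts, Multiset.map_map]
  exact h

theorem one_le_RR (ξ : K Fq) {P Q : Polynomial (Polynomial Fq)} (hP : P ≠ 0) (hQ : Q ≠ 0)
    (hcop : ∀ x, (bar Fq P).eval x = 0 → (bar Fq Q).eval x ≠ 0) :
    1 ≤ RR (lcv Fq P) (lcv Fq Q) (rts Fq ξ P) (rts Fq ξ Q) := by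
  set x := algebraMap (K Fq) (Kbar Fq) ξ with hx
  have hco : IsCoprime (bar Fq P) (bar Fq Q) := by
    rw [isCoprime_iff_aeval_ne_zero_of_isAlgClosed (Kbar Fq) (Kbar Fq)]
    intro a
    simp only [coe_aeval_eq_eval]
    by_cases h : (bar Fq P).eval a = 0
    · exact Or.inr (hcop a h)
    · exact Or.inl h
  have hne : resultant (bar Fq P) (bar Fq Q) ≠ 0 := by
    rw [Ne, resultant_eq_zero_iff]
    exact fun h => h.2 hco
  have h1 : 1 ≤ vv Fq (resultant (bar Fq P) (bar Fq Q)) := by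
    have e : resultant (bar Fq P) (bar Fq Q) =
        embbar Fq (resultant P Q (bar Fq P).natDegree (bar Fq Q).natDegree) :=
      resultant_map_map _ _ _ _ _
    rw [e] at hne ⊢
    rw [vv_embbar]
    exact one_le_absK_emb Fq fun h => hne (by rw [h, map_zero])
  refine h1.trans ?_
  rw [resultant_eq_prod_eval _ _ _ le_rfl (bar_splits Fq P), map_mul, map_pow, map_multiset_prod,
    Multiset.map_map]
  have h2 : (Multiset.map (⇑(vv Fq) ∘ fun a => eval a (bar Fq Q)) (bar Fq P).roots).prod =
      lcv Fq Q ^ Multiset.card (rts Fq ξ P) * ((bar Fq P).roots.map fun a =>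
        ((bar Fq Q).roots.map fun b => vv Fq (a - b)).prod).prod := by
    rw [rts, Multiset.card_map, ← Multiset.prod_replicate, ← Multiset.map_const',
      ← Multiset.prod_map_mul]
    congr 1
    apply Multiset.map_congr rfl
    intro a _
    exact vv_eval Fq Q a
  rw [h2, RR, card_rts Fq ξ Q, bar_natDegree, mul_assoc]
  have hl := one_le_lcv Fq hP
  have hl' := one_le_lcv Fq hQ
  apply mul_le_mul_of_nonneg_left _ (pow_nonneg ((vv Fq).nonneg _) _)
  apply mul_le_mul_of_nonneg_left _ (by positivity)
  rw [dprod, rts, rts, Multiset.map_map]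
  apply Multiset.prod_map_le_prod_map₀
  · intro a _
    apply Multiset.prod_nonneg
    intro z hz
    obtain ⟨b, _, rfl⟩ := Multiset.mem_map.1 hz
    exact (vv Fq).nonneg _
  · intro a _
    simp only [Function.comp, Multiset.map_map]
    apply Multiset.prod_map_le_prod_map₀
    · intro b _; exact (vv Fq).nonneg _
    · intro b _
      have := vv_na Fq (-(x - a)) (x - b)
      rw [(vv Fq).map_neg] at this
      rwa [show -(x - a) + (x - b) = a - b by ring] at this

/-- If the distance multiset has no second element as small as the given root, the root is in `K`. -/
theorem root_in_K (ξ : K Fq) {P : Polynomial (Polynomial Fq)} (hP : P ≠ 0) {a : ℝ}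
    (ha : a ∈ rts Fq ξ P) :
    (∃ A, rts Fq ξ P = a ::ₘ a ::ₘ A) ∨ ∃ α : K Fq, evalK Fq P α = 0 ∧ absK Fq (ξ - α) = a := by
  obtain ⟨z, hz, rfl⟩ := Multiset.mem_map.1 ha
  by_cases hzK : z ∈ (algebraMap (K Fq) (Kbar Fq)).range
  · right
    obtain ⟨α, rfl⟩ := hzK
    refine ⟨α, ?_, ?_⟩
    · have h := (mem_roots'.1 hz).2
      rw [IsRoot.def, bar_eval] at h
      exact (map_eq_zero _).1 h
    · rw [← map_sub, vv_alg]
  · left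
    have hint : IsIntegral (K Fq) z := Algebra.IsIntegral.isIntegral z
    set m := minpoly (K Fq) z with hm
    have hdeg : 2 ≤ m.natDegree := (minpoly.two_le_natDegree_iff hint).2 hzK
    have hroot : aeval z (P.map (emb Fq)) = 0 := by
      have h := (mem_roots'.1 hz).2
      rw [IsRoot.def, bar_eq, eval_map_algebraMap] at h
      exact h
    have hdvd : m.map (algebraMap (K Fq) (Kbar Fq)) ∣ bar Fq P := by
      rw [bar_eq]; exact Polynomial.map_dvd _ (minpoly.dvd _ _ hroot)
    have hle : (m.map (algebraMap (K Fq) (Kbar Fq))).roots ≤ (bar Fq P).roots :=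
      roots.le_of_dvd (bar_ne_zero Fq hP) hdvd
    have hcard : Multiset.card (m.map (algebraMap (K Fq) (Kbar Fq))).roots = m.natDegree := by
      rw [← (IsAlgClosed.splits _).natDegree_eq_card_roots, natDegree_map]
    have hmz : z ∈ (m.map (algebraMap (K Fq) (Kbar Fq))).roots := by
      rw [mem_roots (Polynomial.map_ne_zero (minpoly.ne_zero hint)), IsRoot.def,
        eval_map_algebraMap, minpoly.aeval]
    obtain ⟨t, ht⟩ := Multiset.exists_cons_of_mem hmz
    have ht0 : t ≠ 0 := by
      rintro rfl
      rw [ht] at hcard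
      simp at hcard
      omega
    obtain ⟨y, hy⟩ := Multiset.exists_mem_of_ne_zero ht0
    obtain ⟨t', rfl⟩ := Multiset.exists_cons_of_mem hy
    have hmy : y ∈ (m.map (algebraMap (K Fq) (Kbar Fq))).roots := by rw [ht]; simp
    have hy0 : aeval y m = 0 := by
      have h := (mem_roots'.1 hmy).2
      rwa [IsRoot.def, eval_map_algebraMap] at h
    have hmin : m = minpoly (K Fq) y :=
      minpoly.eq_of_irreducible_of_monic (minpoly.irreducible hint) hy0 (minpoly.monic hint)
    have hdist : vv Fq (algebraMap (K Fq) (Kbar Fq) ξ - y) =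
        vv Fq (algebraMap (K Fq) (Kbar Fq) ξ - z) := by
      rw [(vv Fq).map_sub, (vv Fq).map_sub _ z]
      apply vv_minpoly
      rw [minpoly.sub_algebraMap, minpoly.sub_algebraMap, ← hmin]
    rw [ht] at hle
    obtain ⟨u, hu⟩ := Multiset.le_iff_exists_add.1 hle
    refine ⟨(t' + u).map fun a => vv Fq (algebraMap (K Fq) (Kbar Fq) ξ - a), ?_⟩
    rw [rts, hu]
    simp [hdist]

theorem core_est (ξ : K Fq) {n : ℕ} {P Q : Polynomial (Polynomial Fq)} (hP : P ≠ 0) (hQ : Q ≠ 0)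
    (hcop : ∀ x, (bar Fq P).eval x = 0 → (bar Fq Q).eval x ≠ 0)
    (hPn : P.natDegree ≤ n) (hQn : Q.natDegree ≤ n) (hQ1 : Q.natDegree ≠ 0)
    {a : ℝ} (ha : a ∈ rts Fq ξ P) (hab : ∀ b ∈ rts Fq ξ Q, a ≤ b)
    {GP GQ G : ℝ} (hGP : HP Fq P * cst Fq ξ ^ n ≤ GP) (hGQ : HP Fq Q * cst Fq ξ ^ n ≤ GQ)
    (hGPG : GP ≤ G) (hGQG : GQ ≤ G) :
    1 ≤ absK Fq (evalK Fq Q ξ) ^ 2 * G ^ (2 * n - 2) ∨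
    ∃ α : K Fq, evalK Fq P α = 0 ∧ absK Fq (ξ - α) ≤
      absK Fq (evalK Fq P ξ) * absK Fq (evalK Fq Q ξ) * (GP ^ (n - 1) * GQ ^ (n - 1)) := by
  have hR := one_le_RR Fq ξ hP hQ hcop
  have lP := one_le_lcv Fq hP
  have lQ := one_le_lcv Fq hQ
  have gP1 : 1 ≤ lcv Fq P * gg (rts Fq ξ P) := one_le_mul_of_one_le_of_one_le lP (one_le_gg _)
  have gQ1 : 1 ≤ lcv Fq Q * gg (rts Fq ξ Q) := one_le_mul_of_one_le_of_one_le lQ (one_le_gg _)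
  have gP2 : lcv Fq P * gg (rts Fq ξ P) ≤ GP := (lcv_gg_le Fq ξ hPn).trans hGP
  have gQ2 : lcv Fq Q * gg (rts Fq ξ Q) ≤ GQ := (lcv_gg_le Fq ξ hQn).trans hGQ
  have cP := card_rts Fq ξ P
  have cQ := card_rts Fq ξ Q
  have pairCase : ∀ a₂ A, rts Fq ξ P = a ::ₘ a₂ ::ₘ A → (∀ b ∈ rts Fq ξ Q, a₂ ≤ b) →
      1 ≤ absK Fq (evalK Fq Q ξ) ^ 2 * G ^ (2 * n - 2) := by
    intro a₂ A hA ha₂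
    have h := RR_pair lP lQ a a₂ A (rts Fq ξ Q) (rts_nonneg Fq ξ Q) hab ha₂
    rw [← hA, lcv_prod] at h
    refine hR.trans (h.trans ?_)
    apply mul_le_mul_of_nonneg_left _ (by positivity)
    have hcA : Multiset.card A + 2 = P.natDegree := by rw [← cP, hA]; simp
    calc _ ≤ G ^ Multiset.card (rts Fq ξ Q) * G ^ Multiset.card A := by
          apply mul_le_mul
          · exact pow_le_pow_left₀ (by linarith) (gP2.trans hGPG) _
          · exact pow_le_pow_left₀ (by linarith) (gQ2.trans hGQG) _
          · exact pow_nonneg (by linarith) _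
          · exact pow_nonneg (by linarith) _
      _ = G ^ (Multiset.card (rts Fq ξ Q) + Multiset.card A) := (pow_add _ _ _).symm
      _ ≤ _ := pow_le_pow_right₀ (by linarith) (by omega)
  rcases root_in_K Fq ξ hP ha with ⟨A, hA⟩ | ⟨α, hα0, hα⟩
  · exact Or.inl (pairCase a A hA hab)
  obtain ⟨A, hA⟩ := Multiset.exists_cons_of_mem ha
  by_cases h2 : ∃ a₂ ∈ A, ∀ b ∈ rts Fq ξ Q, a₂ ≤ b
  · obtain ⟨a₂, ha₂, h2⟩ := h2
    obtain ⟨A', rfl⟩ := Multiset.exists_cons_of_mem ha₂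
    exact Or.inl (pairCase a₂ A' hA h2)
  · right
    refine ⟨α, hα0, ?_⟩
    push Not at h2
    have hne : rts Fq ξ Q ≠ 0 := by
      intro h; rw [h] at cQ; simp at cQ; omega
    obtain ⟨b, hb, hbm⟩ := exists_min_mem hne
    obtain ⟨B, hB⟩ := Multiset.exists_cons_of_mem hb
    have ha0 : 0 ≤ a := rts_nonneg Fq ξ P a ha
    have h := RR_single lP lQ a b A B ha0
      (fun a' h' => rts_nonneg Fq ξ P a' (by rw [hA]; exact Multiset.mem_cons_of_mem h'))
      (by rw [← hB]; exact rts_nonneg Fq ξ Q) (by rw [← hB]; exact hab)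
      (fun a' h' => by
        obtain ⟨b', hb', hlt⟩ := h2 a' h'
        exact (hbm b' hb').trans hlt.le)
    rw [← hA, ← hB, lcv_prod, lcv_prod] at h
    rw [hα]
    refine (le_mul_of_one_le_right ha0 hR).trans (h.trans ?_)
    apply mul_le_mul_of_nonneg_left _ (mul_nonneg (absK_nonneg Fq _) (absK_nonneg Fq _))
    have hcA : Multiset.card A + 1 = P.natDegree := by rw [← cP, hA]; simp
    have hcB : Multiset.card B + 1 = Q.natDegree := by rw [← cQ, hB]; simp
    have x1 : (lcv Fq P * gg (rts Fq ξ P)) ^ Multiset.card B ≤ GP ^ (n - 1) :=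
      (pow_le_pow_left₀ (by linarith) gP2 _).trans (pow_le_pow_right₀ (by linarith) (by omega))
    have x2 : (lcv Fq Q * gg (rts Fq ξ Q)) ^ Multiset.card A ≤ GQ ^ (n - 1) :=
      (pow_le_pow_left₀ (by linarith) gQ2 _).trans (pow_le_pow_right₀ (by linarith) (by omega))
    exact mul_le_mul x1 x2 (pow_nonneg (by linarith) _) (pow_nonneg (by linarith) _)

theorem core_alg (ξ : K Fq) {n : ℕ} {P Q : Polynomial (Polynomial Fq)} (hP : P ≠ 0) (hQ : Q ≠ 0)
    (hcop : ∀ x, (bar Fq P).eval x = 0 → (bar Fq Q).eval x ≠ 0)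
    (hPn : P.natDegree ≤ n) (hQn : Q.natDegree ≤ n) (h0 : evalK Fq Q ξ = 0) :
    1 ≤ absK Fq (evalK Fq P ξ) * ((HP Fq P * cst Fq ξ ^ n) ^ (n - 1) *
      (HP Fq Q * cst Fq ξ ^ n) ^ n) := by
  have hR := one_le_RR Fq ξ hP hQ hcop
  have lP := one_le_lcv Fq hP
  have lQ := one_le_lcv Fq hQ
  have gP1 : 1 ≤ lcv Fq P * gg (rts Fq ξ P) := one_le_mul_of_one_le_of_one_le lP (one_le_gg _)
  have gQ1 : 1 ≤ lcv Fq Q * gg (rts Fq ξ Q) := one_le_mul_of_one_le_of_one_le lQ (one_le_gg _)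
  have gP2 := lcv_gg_le Fq ξ hPn
  have gQ2 := lcv_gg_le Fq ξ hQn
  have cP := card_rts Fq ξ P
  have cQ := card_rts Fq ξ Q
  have hmem : (0 : ℝ) ∈ rts Fq ξ Q := by
    refine Multiset.mem_map.2 ⟨algebraMap (K Fq) (Kbar Fq) ξ, ?_, by simp⟩
    rw [mem_roots (bar_ne_zero Fq hQ), IsRoot.def, bar_eval, h0, map_zero]
  obtain ⟨B, hB⟩ := Multiset.exists_cons_of_mem hmem
  have h := RR_zero lP lQ (rts Fq ξ P) B (rts_nonneg Fq ξ P)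
    (fun b hb => rts_nonneg Fq ξ Q b (by rw [hB]; exact Multiset.mem_cons_of_mem hb))
  rw [← hB, lcv_prod] at h
  refine hR.trans (h.trans ?_)
  apply mul_le_mul_of_nonneg_left _ (absK_nonneg Fq _)
  have hcB : Multiset.card B + 1 = Q.natDegree := by rw [← cQ, hB]; simp
  have x1 : (lcv Fq P * gg (rts Fq ξ P)) ^ Multiset.card B ≤ (HP Fq P * cst Fq ξ ^ n) ^ (n - 1) :=
    (pow_le_pow_left₀ (by linarith) gP2 _).trans (pow_le_pow_right₀ (by linarith) (by omega))
  have x2 : (lcv Fq Q * gg (rts Fq ξ Q)) ^ Multiset.card (rts Fq ξ P) ≤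
      (HP Fq Q * cst Fq ξ ^ n) ^ n :=
    (pow_le_pow_left₀ (by linarith) gQ2 _).trans (pow_le_pow_right₀ (by linarith) (by omega))
  exact mul_le_mul x1 x2 (pow_nonneg (by linarith) _) (pow_nonneg (by linarith) _)

theorem no_common_root {P Q : Polynomial (Polynomial Fq)} (hP : Irreducible P) (hQ : Q ≠ 0)
    (hlt : HP Fq Q < HP Fq P) : ∀ x, (bar Fq P).eval x = 0 → (bar Fq Q).eval x ≠ 0 := by
  intro x h1 h2
  rw [bar, eval_map] at h1 h2
  exact absurd (HP_le_of_dvd Fq (gauss_dvd Fq _ (embbar_injective Fq) hP h1 h2) hQ) (not_le.2 hlt)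

theorem one_le_const (ξ : K Fq) {P : Polynomial (Polynomial Fq)} (hP : P.natDegree = 0)
    (hP0 : P ≠ 0) : 1 ≤ absK Fq (evalK Fq P ξ) := by
  rw [eq_C_of_natDegree_eq_zero hP, evalK, eval₂_C]
  apply one_le_absK_emb
  intro h
  apply hP0
  rw [eq_C_of_natDegree_eq_zero hP, h, C_0]

theorem HP_rpow_le_one (P : Polynomial (Polynomial Fq)) {w : ℝ} (hw : 0 ≤ w) :
    HP Fq P ^ (-w) ≤ 1 :=
  Real.rpow_le_one_of_one_le_of_nonpos (one_le_HP Fq P) (by linarith)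

theorem factor_bound (ξ : K Fq) (n : ℕ) {w c : ℝ} (hw : 0 ≤ w) (hc0 : 0 < c) (hc1 : c ≤ 1)
    (h : ∀ F : Polynomial (Polynomial Fq), Irreducible F → F.natDegree ≤ n →
      evalK Fq F ξ ≠ 0 → c * HP Fq F ^ (-w) ≤ absK Fq (evalK Fq F ξ))
    (P : Polynomial (Polynomial Fq)) (hP : P ≠ 0) (hn : P.natDegree ≤ n)
    (he : evalK Fq P ξ ≠ 0) :
    c ^ P.natDegree * HP Fq P ^ (-w) ≤ absK Fq (evalK Fq P ξ) := by
  induction P using WfDvdMonoid.induction_on_irreducible with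
  | zero => exact absurd rfl hP
  | unit u hu =>
    have hd := natDegree_eq_zero_of_isUnit hu
    rw [hd, pow_zero, one_mul]
    exact (HP_rpow_le_one Fq u hw).trans (one_le_const Fq ξ hd hP)
  | mul a i ha hi ih =>
    rw [natDegree_mul hi.ne_zero ha] at hn ⊢
    rw [evalK_mul] at he ⊢
    rw [absK_mul, HP_mul Fq hi.ne_zero ha, Real.mul_rpow (HP_pos Fq i).le (HP_pos Fq a).le, pow_add]
    have h1 := ih ha (by omega) (right_ne_zero_of_mul he)
    have h2 : c ^ i.natDegree * HP Fq i ^ (-w) ≤ absK Fq (evalK Fq i ξ) := by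
      by_cases hd : i.natDegree = 0
      · rw [hd, pow_zero, one_mul]
        exact (HP_rpow_le_one Fq i hw).trans (one_le_const Fq ξ hd hi.ne_zero)
      · refine le_trans ?_ (h i hi (by omega) (left_ne_zero_of_mul he))
        apply mul_le_mul_of_nonneg_right _ (Real.rpow_nonneg (HP_pos Fq i).le _)
        exact pow_le_of_le_one hc0.le hc1 hd
    have h3 := mul_le_mul h2 h1 (mul_nonneg (by positivity) (Real.rpow_nonneg (HP_pos Fq a).le _))
      (absK_nonneg Fq _)
    refine le_trans (le_of_eq ?_) h3
    ring

theorem exists_irr_approx (ξ : K Fq) (n : ℕ) {w w' : ℝ} (hw : w ∈ wnSet Fq ξ n) (hw'0 : 0 ≤ w')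
    (hlt : w' < w) (B : ℝ) : ∃ P : Polynomial (Polynomial Fq), Irreducible P ∧ P.natDegree ≤ n ∧
      B < HP Fq P ∧ 0 < absK Fq (evalK Fq P ξ) ∧ absK Fq (evalK Fq P ξ) < HP Fq P ^ (-w') := by
  by_contra hcon
  push Not at hcon
  obtain ⟨c, hc0, hc1, hc⟩ : ∃ c : ℝ, 0 < c ∧ c ≤ 1 ∧ ∀ F : Polynomial (Polynomial Fq),
      F.natDegree ≤ n → HP Fq F ≤ B → evalK Fq F ξ ≠ 0 → c ≤ absK Fq (evalK Fq F ξ) := by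
    have hfin : (insert (1:ℝ) ((fun F => absK Fq (evalK Fq F ξ)) ''
        {F : Polynomial (Polynomial Fq) | (F.natDegree ≤ n ∧ HP Fq F ≤ B) ∧ evalK Fq F ξ ≠ 0})).Finite :=
      (((finite_HP_le Fq n B).subset fun F hF => hF.1).image _).insert _
    obtain ⟨c, hcm, hcle⟩ := Set.exists_min_image _ id hfin ⟨1, Set.mem_insert _ _⟩
    refine ⟨c, ?_, hcle 1 (Set.mem_insert _ _), fun F h1 h2 h3 =>
      hcle _ (Set.mem_insert_of_mem _ ⟨F, ⟨⟨h1, h2⟩, h3⟩, rfl⟩)⟩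
    rcases hcm with rfl | ⟨F, hF, rfl⟩
    · exact one_pos
    · exact absK_pos Fq hF.2
  have hall : ∀ F : Polynomial (Polynomial Fq), Irreducible F → F.natDegree ≤ n →
      evalK Fq F ξ ≠ 0 → c * HP Fq F ^ (-w') ≤ absK Fq (evalK Fq F ξ) := by
    intro F hF hn hne
    have hp : 0 ≤ HP Fq F ^ (-w') := Real.rpow_nonneg (HP_pos Fq F).le _
    by_cases hB : HP Fq F ≤ B
    · exact (mul_le_of_le_one_right hc0.le (HP_rpow_le_one Fq F hw'0)).trans (hc F hn hB hne)
    · exact (mul_le_of_le_one_left hp hc1).trans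
        (hcon F hF hn (not_le.1 hB) (absK_pos Fq hne))
  obtain ⟨B', _, hB'⟩ := exists_beats ((c ^ n)⁻¹) (w - w') (by linarith)
  apply hw
  refine (finite_HP_le Fq n B').subset ?_
  rintro P ⟨h1, h2, h3⟩
  refine ⟨h1, ?_⟩
  by_contra hB
  have hb := hB' _ (not_le.1 hB)
  have hne : evalK Fq P ξ ≠ 0 := (absK_pos_iff Fq).1 h2
  have hP0 : P ≠ 0 := by rintro rfl; simp [evalK] at hne
  have h4 := factor_bound Fq ξ n hw'0 hc0 hc1 hall P hP0 h1 hne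
  have hH := HP_pos Fq P
  have h5 : c ^ n * HP Fq P ^ (-w') ≤ c ^ P.natDegree * HP Fq P ^ (-w') :=
    mul_le_mul_of_nonneg_right (pow_le_pow_of_le_one hc0.le hc1 h1) (Real.rpow_nonneg hH.le _)
  have h6 : c ^ n * HP Fq P ^ (-w') < HP Fq P ^ (-(w - w')) * HP Fq P ^ (-w') := by
    rw [← Real.rpow_add hH]
    refine (h5.trans h4).trans_lt (h3.trans_eq ?_)
    ring_nf
  have h7 := lt_of_mul_lt_mul_right h6 (Real.rpow_nonneg hH.le _)
  have hcn : 0 < c ^ n := by positivity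
  rw [inv_mul_lt_iff₀ hcn, mul_one] at hb
  linarith

theorem infinite_of_close (ξ : K Fq) (S : Set (K Fq)) (hS : ∀ α ∈ S, 0 < absK Fq (ξ - α))
    (h : ∀ δ : ℝ, 0 < δ → ∃ α ∈ S, absK Fq (ξ - α) < δ) : S.Infinite := by
  intro hfin
  obtain ⟨α₀, hα₀, _⟩ := h 1 one_pos
  obtain ⟨α, hα, hmin⟩ := Set.exists_min_image S (fun α => absK Fq (ξ - α)) hfin ⟨α₀, hα₀⟩
  obtain ⟨β, hβ, hlt⟩ := h _ (hS α hα)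
  exact absurd (hmin β hβ) (not_le.2 hlt)

theorem not_algDegLe (ξ : K Fq) (n : ℕ) (hn : 1 ≤ n) {w : ℝ} (hw : w ∈ wnSet Fq ξ n)
    (hwn : (n : ℝ) - 1 < w) : ¬ IsAlgDegLe Fq ξ n := by
  rintro ⟨M, hM0, hMn, hM⟩
  have hn' : (1:ℝ) ≤ n := by exact_mod_cast hn
  obtain ⟨w', h1, h2⟩ := exists_between hwn
  obtain ⟨B, hB1, hB⟩ := exists_beats ((cst Fq ξ ^ n) ^ (n - 1) * (HP Fq M * cst Fq ξ ^ n) ^ n)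
    (w' - (n - 1)) (by linarith)
  obtain ⟨P, hPi, hPn, hPB, hP0, hPlt⟩ := exists_irr_approx Fq ξ n hw (w' := w') (by linarith) h2
    (max B (HP Fq M))
  have hlt := (le_max_right _ _).trans_lt hPB
  have h := core_alg Fq ξ hPi.ne_zero hM0 (no_common_root Fq hPi hM0 hlt) hPn hMn hM
  have hb := hB _ ((le_max_left _ _).trans_lt hPB)
  have hH := HP_pos Fq P
  have hc := one_le_cst Fq ξ
  have hHM := HP_pos Fq M
  have e : HP Fq P ^ (-(w' - ((n:ℝ) - 1))) = HP Fq P ^ (-w') * HP Fq P ^ (n - 1) := by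
    rw [← Real.rpow_natCast (HP Fq P) (n - 1), ← Real.rpow_add hH]
    push_cast [hn]
    ring_nf
  rw [e] at hb
  have h3 := mul_le_mul_of_nonneg_right hPlt.le (show 0 ≤ ((HP Fq P * cst Fq ξ ^ n) ^ (n - 1) *
      (HP Fq M * cst Fq ξ ^ n) ^ n) by positivity)
  have h4 := h.trans h3
  rw [mul_pow (HP Fq P)] at h4
  linarith

theorem finish (ξ α : K Fq) {n : ℕ} (hn : 1 ≤ n) {w' w'' C₂ H : ℝ} (hw'' : 0 ≤ w'') (hC : 0 ≤ C₂)
    {R : Polynomial (Polynomial Fq)} (hR : R ≠ 0)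
    (hRn : R.natDegree ≤ n) (hα : evalK Fq R α = 0) (hξ : evalK Fq R ξ ≠ 0)
    (hRH : HP Fq R ≤ H) (hb : C₂ * H ^ (-(w' - w'' - n + 1)) < 1)
    (hle : absK Fq (ξ - α) ≤ C₂ * H ^ (-w' - 1) * HP Fq R ^ (n - 1)) :
    (IsAlgK Fq α ∧ degA Fq α ≤ n ∧ 0 < absK Fq (ξ - α) ∧
      absK Fq (ξ - α) < HA Fq α ^ (-w'' - 1)) ∧
    absK Fq (ξ - α) ≤ C₂ * H ^ (-(w' - w'' - n + 1)) := by
  have hRp := HP_pos Fq R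
  have hR1 := one_le_HP Fq R
  have hH : 0 < H := by linarith
  have hn' : (1:ℝ) ≤ n := by exact_mod_cast hn
  have key : absK Fq (ξ - α) ≤ C₂ * H ^ (-(w' - w'' - n + 1)) * HP Fq R ^ (-w'' - 1) := by
    refine hle.trans ?_
    have e1 : H ^ (-w' - 1) = H ^ (-(w' - w'' - n + 1)) * H ^ (-(w'' + n)) := by
      rw [← Real.rpow_add hH]; ring_nf
    have e2 : HP Fq R ^ (-w'' - 1) = HP Fq R ^ (-(w'' + n)) * HP Fq R ^ (n - 1) := by
      rw [← Real.rpow_natCast (HP Fq R) (n - 1), ← Real.rpow_add hRp]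
      push_cast [hn]
      ring_nf
    have e3 : H ^ (-(w'' + n)) ≤ HP Fq R ^ (-(w'' + n)) :=
      Real.rpow_le_rpow_of_nonpos hRp hRH (by linarith)
    rw [e1, e2]
    have := mul_le_mul_of_nonneg_left e3
      (show 0 ≤ C₂ * H ^ (-(w' - w'' - n + 1)) * HP Fq R ^ (n - 1) by positivity)
    linarith
  have hpos : 0 < HP Fq R ^ (-w'' - 1) := Real.rpow_pos_of_pos hRp _
  obtain ⟨hA1, hA2⟩ := HA_le Fq hR hα
  refine ⟨⟨⟨R, hR, hα⟩, (degA_le Fq hR hα).trans hRn, ?_, ?_⟩, ?_⟩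
  · apply absK_pos
    intro h0
    rw [sub_eq_zero] at h0
    rw [h0] at hξ
    exact hξ hα
  · calc _ ≤ _ := key
      _ < 1 * HP Fq R ^ (-w'' - 1) := mul_lt_mul_of_pos_right hb hpos
      _ = HP Fq R ^ (-w'' - 1) := one_mul _
      _ ≤ HA Fq α ^ (-w'' - 1) :=
        Real.rpow_le_rpow_of_nonpos (by linarith) hA2 (by linarith)
  · refine key.trans (mul_le_of_le_one_right (by positivity) ?_)
    exact Real.rpow_le_one_of_one_le_of_nonpos hR1 (by linarith)

theorem lower_mem (ξ : K Fq) (n : ℕ) (hn : 1 ≤ n) {w w'' : ℝ} (hw : w ∈ wnSet Fq ξ n)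
    (hw''0 : 0 ≤ w'') (hlt : w'' < w - n + 1) : w'' ∈ wnstarSet Fq ξ n := by
  have hn' : (1:ℝ) ≤ n := by exact_mod_cast hn
  have hnalg := not_algDegLe Fq ξ n hn hw (by linarith)
  have hnz : ∀ R : Polynomial (Polynomial Fq), R ≠ 0 → R.natDegree ≤ n → evalK Fq R ξ ≠ 0 :=
    fun R h1 h2 h3 => hnalg ⟨R, h1, h2, h3⟩
  apply infinite_of_close Fq ξ
  · rintro α ⟨_, _, h, _⟩; exact h
  intro δ hδ
  obtain ⟨w', hw'1, hw'2⟩ := exists_between (show w'' + n - 1 < w by linarith)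
  obtain ⟨D, hD, hdir⟩ := dirichlet Fq ξ n
  have hc := one_le_cst Fq ξ
  set c := cst Fq ξ ^ n with hcdef
  have hc1 : 1 ≤ c := one_le_pow₀ hc
  set C₂ := D * (c ^ (n - 1) * c ^ (n - 1)) with hC₂
  have hC₂0 : 0 < C₂ := by positivity
  obtain ⟨B1, hB1, hb1⟩ := exists_beats (D ^ 2 * c ^ (2 * n - 2)) 2 (by norm_num)
  obtain ⟨B2, hB2, hb2⟩ := exists_beats (c ^ (2 * n - 2)) (2 * (w' - (n - 1))) (by linarith)
  obtain ⟨B3, hB3, hb3⟩ := exists_beats C₂ (w' - w'' - n + 1) (by linarith)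
  obtain ⟨B4, hB4, hb4⟩ := exists_beats (C₂ / δ) (w' - w'' - n + 1) (by linarith)
  obtain ⟨P, hPi, hPn, hPB, hP0, hPlt⟩ := exists_irr_approx Fq ξ n hw (w' := w') (by linarith) hw'2
    (max (max B1 B2) (max B3 B4))
  set H := HP Fq P with hHdef
  have hHpos : 0 < H := HP_pos Fq P
  replace hb1 := hb1 H (((le_max_left _ _).trans (le_max_left _ _)).trans_lt hPB)
  replace hb2 := hb2 H (((le_max_right _ _).trans (le_max_left _ _)).trans_lt hPB)
  have hB3H : B3 < H := ((le_max_left _ _).trans (le_max_right _ _)).trans_lt hPB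
  replace hb3 := hb3 H hB3H
  replace hb4 := hb4 H (((le_max_right _ _).trans (le_max_right _ _)).trans_lt hPB)
  have hH1 : 1 < H := by linarith
  -- the auxiliary polynomial
  obtain ⟨h, hh⟩ : ∃ h : ℕ, H = (Fintype.card Fq : ℝ) ^ h := ⟨_, rfl⟩
  have hh1 : 1 ≤ h := by
    rcases Nat.eq_zero_or_pos h with rfl | h1
    · rw [pow_zero] at hh; linarith
    · exact h1
  obtain ⟨Q, hQ0, hQn, hQH, hQs⟩ := hdir h hh1
  rw [← hh] at hQH
  rw [mul_comm n h, pow_mul, ← hh] at hQs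
  have hpow : H ^ (2 * n - 2) * H ^ (2 : ℕ) = (H ^ n) ^ 2 := by
    rw [← pow_add, ← pow_mul]; congr 1; omega
  set G := H * c with hG
  have hG1 : 1 ≤ G := one_le_mul_of_one_le_of_one_le hH1.le hc1
  have hQ2 : absK Fq (evalK Fq Q ξ) ^ 2 * G ^ (2 * n - 2) < 1 := by
    refine lt_of_le_of_lt ?_ hb1
    have x1 := mul_le_mul_of_nonneg_right (pow_le_pow_left₀ (absK_nonneg Fq _) hQs 2)
      (show 0 ≤ G ^ (2 * n - 2) by positivity)
    refine x1.trans (le_of_eq ?_)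
    have e : H ^ (-2 : ℝ) = (H ^ (2:ℕ))⁻¹ := by
      rw [Real.rpow_neg hHpos.le]; norm_cast
    rw [e, hG, mul_pow, mul_pow, inv_pow, ← hpow]
    field_simp
  have hP2 : absK Fq (evalK Fq P ξ) ^ 2 * G ^ (2 * n - 2) < 1 := by
    refine lt_of_le_of_lt ?_ hb2
    have x1 := mul_le_mul_of_nonneg_right (pow_le_pow_left₀ (absK_nonneg Fq _) hPlt.le 2)
      (show 0 ≤ G ^ (2 * n - 2) by positivity)
    refine x1.trans (le_of_eq ?_)
    have e : H ^ (-(2 * (w' - ((n:ℝ) - 1)))) = (H ^ (-w')) ^ 2 * H ^ (2 * n - 2) := by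
      rw [← Real.rpow_natCast H (2 * n - 2), ← Real.rpow_natCast (H ^ (-w')) 2,
        ← Real.rpow_mul hHpos.le, ← Real.rpow_add hHpos]
      have : ((2 * n - 2 : ℕ) : ℝ) = 2 * n - 2 := by
        rw [Nat.cast_sub (by omega)]; push_cast; ring
      rw [this]
      push_cast
      ring_nf
    rw [e, hG, mul_pow]
    ring
  have small_deg : ∀ R : Polynomial (Polynomial Fq), R ≠ 0 →
      absK Fq (evalK Fq R ξ) ^ 2 * G ^ (2 * n - 2) < 1 → R.natDegree ≠ 0 := by
    intro R hR hlt hd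
    have h1 := one_le_const Fq ξ hd hR
    have := one_le_mul_of_one_le_of_one_le (one_le_pow₀ h1 : 1 ≤ absK Fq (evalK Fq R ξ) ^ 2)
      (one_le_pow₀ hG1 : 1 ≤ G ^ (2 * n - 2))
    linarith
  have hQd := small_deg Q hQ0 hQ2
  have hPd := small_deg P hPi.ne_zero hP2
  have hcop := no_common_root Fq hPi hQ0 hQH
  have hGQG : HP Fq Q * c ≤ G := mul_le_mul_of_nonneg_right hQH.le (by linarith)
  have hHQ := HP_pos Fq Q
  have hmain : absK Fq (evalK Fq P ξ) * absK Fq (evalK Fq Q ξ) *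
      ((H * c) ^ (n - 1) * (HP Fq Q * c) ^ (n - 1)) ≤ C₂ * H ^ (-w' - 1) * HP Fq Q ^ (n - 1) := by
    have x1 := mul_le_mul hPlt.le hQs (absK_nonneg Fq _) (Real.rpow_nonneg hHpos.le _)
    have x2 := mul_le_mul_of_nonneg_right x1
      (show 0 ≤ ((H * c) ^ (n - 1) * (HP Fq Q * c) ^ (n - 1)) by positivity)
    refine x2.trans (le_of_eq ?_)
    have e : H ^ (-w' - 1) = H ^ (-w') * (H ^ n)⁻¹ * H ^ (n - 1) := by
      rw [← Real.rpow_natCast H n, ← Real.rpow_neg hHpos.le, ← Real.rpow_natCast H (n - 1),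
        ← Real.rpow_add hHpos, ← Real.rpow_add hHpos]
      push_cast [hn]
      ring_nf
    rw [e, hC₂, mul_pow, mul_pow]
    ring
  have conclude : ∀ (R : Polynomial (Polynomial Fq)) (α : K Fq), R ≠ 0 → R.natDegree ≤ n →
      evalK Fq R α = 0 → HP Fq R ≤ H →
      absK Fq (ξ - α) ≤ C₂ * H ^ (-w' - 1) * HP Fq R ^ (n - 1) →
      ∃ α ∈ {α : K Fq | IsAlgK Fq α ∧ degA Fq α ≤ n ∧ 0 < absK Fq (ξ - α) ∧
        absK Fq (ξ - α) < HA Fq α ^ (-w'' - 1)}, absK Fq (ξ - α) < δ := by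
    intro R α hR hRn hRα hRH hle
    obtain ⟨x1, x2⟩ := finish Fq ξ α hn hw''0 hC₂0.le hR hRn hRα (hnz R hR hRn) hRH hb3 hle
    refine ⟨α, x1, x2.trans_lt ?_⟩
    rw [div_mul_eq_mul_div, div_lt_one hδ] at hb4
    exact hb4
  have hneP : rts Fq ξ P ≠ 0 := by
    intro h0; have := card_rts Fq ξ P; rw [h0] at this; simp at this; omega
  have hneQ : rts Fq ξ Q ≠ 0 := by
    intro h0; have := card_rts Fq ξ Q; rw [h0] at this; simp at this; omega
  obtain ⟨a, ha, hamin⟩ := exists_min_mem hneP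
  obtain ⟨b, hb, hbmin⟩ := exists_min_mem hneQ
  rcases le_total a b with hab | hab
  · rcases core_est Fq ξ hPi.ne_zero hQ0 hcop hPn hQn hQd ha (fun b' hb' => hab.trans (hbmin b' hb'))
      le_rfl le_rfl (G := G) le_rfl hGQG with hx | ⟨α, hα, hle⟩
    · linarith
    · refine conclude P α hPi.ne_zero hPn hα le_rfl ((hle.trans hmain).trans ?_)
      apply mul_le_mul_of_nonneg_left _ (by positivity)
      exact pow_le_pow_left₀ hHQ.le hQH.le _
  · rcases core_est Fq ξ hQ0 hPi.ne_zero (fun x h1 h2 => hcop x h2 h1) hQn hPn hPd hb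
      (fun a' ha' => hab.trans (hamin a' ha'))
      le_rfl le_rfl (G := G) hGQG le_rfl with hx | ⟨α, hα, hle⟩
    · linarith
    · refine conclude Q α hQ0 hQn hα hQH.le (le_trans (le_of_eq_of_le ?_ hle) (le_of_eq_of_le ?_ hmain))
      · rfl
      · ring

theorem wn_le (ξ : K Fq) (n : ℕ) (hn : 1 ≤ n) :
    wn Fq ξ n - (n : EReal) + 1 ≤ wnstar Fq ξ n := by
  have hn' : (1:ℝ) ≤ n := by exact_mod_cast hn
  have h0 := wnstar_nonneg Fq ξ n hn
  have key : wn Fq ξ n ≤ wnstar Fq ξ n + (((n : ℝ) - 1 : ℝ) : EReal) := by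
    apply sSup_le
    rintro _ ⟨w, hw, rfl⟩
    have h1 : ((w - (n - 1) : ℝ) : EReal) ≤ wnstar Fq ξ n := by
      by_cases hwn : w - (n - 1) ≤ 0
      · exact (EReal.coe_le_coe_iff.2 hwn).trans h0
      · push Not at hwn
        apply ereal_le_of_forall 0 _ _ hwn
        intro w'' h1 h2
        exact wnstar_ge_of Fq ξ n (lower_mem Fq ξ n hn hw h1.le (by linarith))
    have h2 := add_le_add_left h1 (((n : ℝ) - 1 : ℝ) : EReal)
    rw [← EReal.coe_add] at h2
    simpa using h2
  have h3 : wn Fq ξ n - (((n : ℝ) - 1 : ℝ) : EReal) ≤ wnstar Fq ξ n :=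
    EReal.sub_le_of_le_add key
  refine le_trans (le_of_eq ?_) h3
  rw [sub_eq_add_neg, sub_eq_add_neg, add_assoc]
  congr 1
  rw [← EReal.coe_neg, show -((n:ℝ) - 1) = -(n:ℝ) + 1 by ring, EReal.coe_add, EReal.coe_neg]
  rfl

/-- `w_n(ξ) - n + 1 ≤ w_n^*(ξ) ≤ w_n(ξ)`. -/
theorem wnstar_wn_ineq (Fq : Type) [Field Fq] [Fintype Fq]
    (ξ : K Fq) (n : ℕ) (hn : 1 ≤ n) :
    wn Fq ξ n - (n : EReal) + 1 ≤ wnstar Fq ξ n ∧ wnstar Fq ξ n ≤ wn Fq ξ n := by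
  exact ⟨wn_le Fq ξ n hn, wnstar_le_wn Fq ξ n⟩

end
end MahlerKoksmaFq
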